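/- arXiv:1111.0587 — 2 statements merged into one kernel-verified Lean document; each statement's English description precedes it below -/
import Mathlib

section
/- Let m ≥ 7, t ≥ 3, and let n be an integer with binom(m−1, ⌊m/2⌋−1) + m − 3⌊m/2⌋ < n ≤ binom(m−1, ⌊m/2⌋−1). Then CAN(t, n+t−2, 2) ≥ 2^{t−3}·(2m+1) if m is odd, and CAN(t, n+t−2, 2) ≥ 2^{t−2}·(m+1) if m is even. -/
/-- An `m × n` matrix over `B_q = {0,…,q-1}` is a `t`-covering array if for any `t`
distinct column indices and any `q`-ary vector of length `t`, some row realizes it. -/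
def IsCoveringArray (m n q t : ℕ) (C : Fin m → Fin n → Fin q) : Prop :=
  ∀ cols : Fin t → Fin n, Function.Injective cols →
    ∀ v : Fin t → Fin q, ∃ r : Fin m, ∀ j : Fin t, C r (cols j) = v j

/-- `CAN t n q` : the minimal size `m` for which a `CA(m; t, n, q)` exists. -/
noncomputable def CAN (t n q : ℕ) : ℕ :=
  sInf { m | ∃ C : Fin m → Fin n → Fin q, IsCoveringArray m n q t C }

/-- The weight of the `i`-th column: the number of nonzero entries. -/
def colWt {m n q : ℕ} (C : Fin m → Fin n → Fin q) (i : Fin n) : ℕ :=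
  (Finset.univ.filter fun r : Fin m => (C r i : ℕ) ≠ 0).card

/-- The support of the `i`-th column: the set of coordinates where it is nonzero. -/
def colSupp {m n q : ℕ} (C : Fin m → Fin n → Fin q) (i : Fin n) : Finset (Fin m) :=
  Finset.univ.filter fun r : Fin m => (C r i : ℕ) ≠ 0

/-- The Hamming distance between the `i`-th and `j`-th columns. -/
def colDist {m n q : ℕ} (C : Fin m → Fin n → Fin q) (i j : Fin n) : ℕ :=
  (Finset.univ.filter fun r : Fin m => C r i ≠ C r j).card

/-- Two arrays are equivalent if one is obtained from the other by a row permutation,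
a column permutation, and value permutations applied columnwise. -/
def CAEquiv {m n q : ℕ} (C C' : Fin m → Fin n → Fin q) : Prop :=
  ∃ (σ : Equiv.Perm (Fin m)) (τ : Equiv.Perm (Fin n)) (f : Fin n → Equiv.Perm (Fin q)),
    ∀ r i, C' r i = f i (C (σ r) (τ i))

/-- The standard maximal binary 2-covering array of size `m` : an
`m × (m-1).choose (m/2 - 1)` binary matrix whose first row is all ones and whose columns,
restricted to the remaining `m - 1` rows, are exactly (i.e. are pairwise distinct) the binary
vectors of length `m-1` with `m/2 - 1` ones. -/
def IsStandardMaxArray (m : ℕ) (S : Fin m → Fin ((m-1).choose (m/2 - 1)) → Fin 2) : Prop :=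
  (∀ (r : Fin m) (i), (r : ℕ) = 0 → S r i = 1) ∧
  (Function.Injective fun i => fun r => S r i) ∧
  (∀ i, (Finset.univ.filter fun r : Fin m => (r : ℕ) ≠ 0 ∧ S r i = 1).card = m/2 - 1)

section SetFamilies

variable {α : Type} [Fintype α] [DecidableEq α]

/-- The `j`-sets that contain a member of `F` but do not contain `A`. -/
def levelAbove (F : Finset (Finset α)) (A : Finset α) (j : ℕ) : Finset (Finset α) :=
  Finset.univ.filter fun S => S.card = j ∧ ¬ A ⊆ S ∧ ∃ B ∈ F, B ⊆ S

theorem mem_levelAbove {F : Finset (Finset α)} {A S : Finset α} {j : ℕ} :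
    S ∈ levelAbove F A j ↔ S.card = j ∧ ¬ A ⊆ S ∧ ∃ B ∈ F, B ⊆ S := by
  simp [levelAbove]

theorem card_insert_avoiding (A T : Finset α) (hT : ¬ A ⊆ T) :
    Fintype.card α ≤ (Finset.univ.filter fun x => x ∉ T ∧ ¬ A ⊆ insert x T).card + T.card + 1 := by
  have hbad : (Finset.univ.filter fun x => A ⊆ insert x T).card ≤ 1 := by
    rw [Finset.card_le_one]
    intro x hx y hy
    simp only [Finset.mem_filter, Finset.mem_univ, true_and] at hx hy
    by_contra hxy
    refine hT fun a ha => ?_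
    have h1 := Finset.mem_insert.1 (hx ha)
    have h2 := Finset.mem_insert.1 (hy ha)
    grind
  have hcover : (Finset.univ : Finset α) ⊆
      ((Finset.univ.filter fun x => x ∉ T ∧ ¬ A ⊆ insert x T) ∪ T) ∪
        (Finset.univ.filter fun x => A ⊆ insert x T) := by
    intro x _
    simp only [Finset.mem_union, Finset.mem_filter, Finset.mem_univ, true_and]
    tauto
  have h1 := Finset.card_le_card hcover
  have h2 := Finset.card_union_le
    ((Finset.univ.filter fun x => x ∉ T ∧ ¬ A ⊆ insert x T) ∪ T)
    (Finset.univ.filter fun x => A ⊆ insert x T)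
  have h3 := Finset.card_union_le (Finset.univ.filter fun x => x ∉ T ∧ ¬ A ⊆ insert x T) T
  rw [Finset.card_univ] at h1
  omega

theorem card_levelAbove_le_upper (F : Finset (Finset α)) (A : Finset α) (j : ℕ)
    (hj : 2 * (j + 1) ≤ Fintype.card α) :
    (levelAbove F A j).card ≤
      ((levelAbove F A (j + 1)).filter fun S => ∃ T ∈ levelAbove F A j, T ⊆ S).card := by
  have key := Finset.card_mul_le_card_mul (s := levelAbove F A j)
    (t := (levelAbove F A (j + 1)).filter fun S => ∃ T ∈ levelAbove F A j, T ⊆ S)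
    (m := j + 1) (n := j + 1) (fun T S => T ⊆ S) ?_ ?_
  · exact Nat.le_of_mul_le_mul_right key (Nat.succ_pos j)
  · intro T hT
    obtain ⟨hTc, hAT, B, hB, hBT⟩ := mem_levelAbove.1 hT
    have hcard := card_insert_avoiding A T hAT
    have himg : ((Finset.univ.filter fun x => x ∉ T ∧ ¬ A ⊆ insert x T).image
        fun x => insert x T) ⊆
        Finset.bipartiteAbove (fun T S => T ⊆ S)
          ((levelAbove F A (j + 1)).filter fun S => ∃ T ∈ levelAbove F A j, T ⊆ S) T := by
      intro S hS
      obtain ⟨x, hx, rfl⟩ := Finset.mem_image.1 hS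
      simp only [Finset.mem_filter, Finset.mem_univ, true_and] at hx
      rw [Finset.mem_bipartiteAbove, Finset.mem_filter, mem_levelAbove]
      refine ⟨⟨⟨?_, hx.2, B, hB, hBT.trans (Finset.subset_insert _ _)⟩, T, hT,
        Finset.subset_insert _ _⟩, Finset.subset_insert _ _⟩
      rw [Finset.card_insert_of_notMem hx.1, hTc]
    have h1 := Finset.card_le_card himg
    rw [Finset.card_image_of_injOn] at h1
    · omega
    · intro x hx y hy hxy
      simp only [Finset.coe_filter, Finset.mem_univ, true_and, Set.mem_ofPred_eq] at hx hy
      have : x ∈ insert y T := by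
        have : x ∈ insert x T := Finset.mem_insert_self _ _
        simpa only [hxy] using this
      rcases Finset.mem_insert.1 this with h | h
      · exact h
      · exact absurd h hx.1
  · intro S hS
    obtain ⟨hSc, -⟩ := mem_levelAbove.1 (Finset.mem_filter.1 hS).1
    have : Finset.bipartiteBelow (fun T S => T ⊆ S) (levelAbove F A j) S ⊆
        S.powersetCard j := by
      intro T hT
      rw [Finset.mem_bipartiteBelow] at hT
      exact Finset.mem_powersetCard.2 ⟨hT.2, (mem_levelAbove.1 hT.1).1⟩
    refine (Finset.card_le_card this).trans ?_
    rw [Finset.card_powersetCard, hSc, Nat.choose_succ_self_right]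

theorem IsAntichain.card_le_card_levelAbove {F : Finset (Finset α)} {A : Finset α}
    (hF : IsAntichain (· ⊆ ·) (F : Set (Finset α))) (hA : ∀ B ∈ F, ¬ A ⊆ B) (j : ℕ)
    (hj : 2 * j ≤ Fintype.card α) :
    (F.filter fun B => B.card ≤ j).card ≤ (levelAbove F A j).card := by
  induction j with
  | zero =>
    refine Finset.card_le_card fun B hB => ?_
    rw [Finset.mem_filter] at hB
    exact mem_levelAbove.2 ⟨Nat.le_zero.1 hB.2, hA B hB.1, B, hB.1, subset_rfl⟩
  | succ j ih =>
    have hsplit : (F.filter fun B => B.card ≤ j + 1) =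
        (F.filter fun B => B.card ≤ j) ∪ (F.filter fun B => B.card = j + 1) := by
      ext B
      simp only [Finset.mem_filter, Finset.mem_union]
      grind
    have hdisj : Disjoint (F.filter fun B => B.card = j + 1)
        ((levelAbove F A (j + 1)).filter fun S => ∃ T ∈ levelAbove F A j, T ⊆ S) := by
      rw [Finset.disjoint_left]
      intro S hS hS'
      rw [Finset.mem_filter] at hS hS'
      obtain ⟨T, hT, hTS⟩ := hS'.2
      obtain ⟨hTc, -, B, hB, hBT⟩ := mem_levelAbove.1 hT
      have hBS : B = S := by
        by_contra hne
        exact hF hB hS.1 hne (hBT.trans hTS)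
      have := Finset.card_le_card hBT
      subst hBS
      omega
    have hsub : (F.filter fun B => B.card = j + 1) ∪
        ((levelAbove F A (j + 1)).filter fun S => ∃ T ∈ levelAbove F A j, T ⊆ S) ⊆
        levelAbove F A (j + 1) := by
      refine Finset.union_subset (fun B hB => ?_) (Finset.filter_subset _ _)
      rw [Finset.mem_filter] at hB
      exact mem_levelAbove.2 ⟨hB.2, hA B hB.1, B, hB.1, subset_rfl⟩
    have h1 := Finset.card_le_card hsub
    rw [Finset.card_union_of_disjoint hdisj] at h1
    have h2 := card_levelAbove_le_upper F A j hj
    have h3 := ih (by omega)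
    have h4 := Finset.card_union_le (F.filter fun B => B.card ≤ j)
      (F.filter fun B => B.card = j + 1)
    rw [hsplit]
    omega

theorem erdos_ko_rado_fintype {F : Finset (Finset α)} {r : ℕ}
    (hF : (F : Set (Finset α)).Intersecting) (hr : (F : Set (Finset α)).Sized r)
    (h : r ≤ Fintype.card α / 2) : F.card ≤ (Fintype.card α - 1).choose (r - 1) := by
  let e := Fintype.equivFin α
  have hinj : Function.Injective fun B : Finset α => B.map e.toEmbedding :=
    Finset.map_injective _
  rw [← Finset.card_image_of_injective F hinj]
  refine Finset.erdos_ko_rado ?_ ?_ h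
  · intro S hS T hT
    simp only [Finset.coe_image, Set.mem_image, Finset.mem_coe] at hS hT
    obtain ⟨B, hB, rfl⟩ := hS
    obtain ⟨D, hD, rfl⟩ := hT
    rw [Finset.disjoint_map]
    exact hF hB hD
  · intro S hS
    simp only [Finset.coe_image, Set.mem_image, Finset.mem_coe] at hS
    obtain ⟨B, hB, rfl⟩ := hS
    rw [Finset.card_map]
    exact hr hB

theorem card_supersets {A : Finset α} {k : ℕ} (hA : A.card + 1 = k) :
    (Finset.univ.filter fun S : Finset α => S.card = k ∧ A ⊆ S).card + A.card
      = Fintype.card α := by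
  have : (Finset.univ.filter fun S : Finset α => S.card = k ∧ A ⊆ S) =
      Aᶜ.image fun x => insert x A := by
    ext S
    simp only [Finset.mem_filter, Finset.mem_univ, true_and, Finset.mem_image, Finset.mem_compl]
    constructor
    · rintro ⟨hS, hAS⟩
      have h1 : (S \ A).card = 1 := by
        rw [Finset.card_sdiff_of_subset hAS]
        omega
      obtain ⟨x, hx⟩ := Finset.card_eq_one.1 h1
      have hxS : x ∈ S \ A := by simp [hx]
      refine ⟨x, (Finset.mem_sdiff.1 hxS).2, ?_⟩
      rw [Finset.insert_eq, ← hx, Finset.sdiff_union_of_subset hAS]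
    · rintro ⟨x, hx, rfl⟩
      exact ⟨by rw [Finset.card_insert_of_notMem hx, hA], Finset.subset_insert _ _⟩
  rw [this, Finset.card_image_of_injOn, Finset.card_compl]
  · have := Finset.card_le_univ A
    omega
  · intro x hx y hy hxy
    simp only [Finset.coe_compl, Set.mem_compl_iff, Finset.mem_coe] at hx
    have : x ∈ insert y A := by
      have : x ∈ insert x A := Finset.mem_insert_self _ _
      simpa only [hxy] using this
    exact (Finset.mem_insert.1 this).resolve_right hx

/-- An intersecting antichain of sets of size at most half the ground set is either uniform, or
smaller than the Erdős–Ko–Rado bound by a linear amount. -/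
theorem IsAntichain.uniform_or_card_add_le {F : Finset (Finset α)} {k : ℕ}
    (hF : IsAntichain (· ⊆ ·) (F : Set (Finset α)))
    (hint : (F : Set (Finset α)).Intersecting) (hk : k = Fintype.card α / 2)
    (hsize : ∀ B ∈ F, B.card ≤ k) :
    (∀ B ∈ F, B.card = k) ∨
      F.card + (Fintype.card α - k) ≤ (Fintype.card α - 1).choose (k - 1) := by
  by_cases hun : ∀ B ∈ F, B.card = k
  · exact Or.inl hun
  right
  push Not at hun
  obtain ⟨A₀, hA₀, hne⟩ := hun
  have hlt : A₀.card < k := lt_of_le_of_ne (hsize A₀ hA₀) hne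
  obtain ⟨A, hAA, -, hAc⟩ := Finset.exists_subsuperset_card_eq (Finset.subset_univ A₀)
    (show A₀.card ≤ k - 1 by omega) (by rw [Finset.card_univ]; omega)
  have hanti : IsAntichain (· ⊆ ·) ((F.erase A₀ : Finset (Finset α)) : Set (Finset α)) :=
    hF.subset (by simp)
  have havoid : ∀ B ∈ F.erase A₀, ¬ A ⊆ B := fun B hB hAB =>
    hF hA₀ (Finset.mem_of_mem_erase hB) (Finset.ne_of_mem_erase hB).symm (hAA.trans hAB)
  have h1 := hanti.card_le_card_levelAbove havoid k (by omega)
  rw [Finset.filter_true_of_mem (fun B hB => hsize B (Finset.mem_of_mem_erase hB)),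
    Finset.card_erase_of_mem hA₀] at h1
  have h2 := card_supersets (A := A) (k := k) (by omega)
  have hdisj : Disjoint (levelAbove (F.erase A₀) A k)
      (Finset.univ.filter fun S : Finset α => S.card = k ∧ A ⊆ S) := by
    rw [Finset.disjoint_left]
    intro S hS hS'
    exact (mem_levelAbove.1 hS).2.1 (Finset.mem_filter.1 hS').2.2
  have hsup : ∀ S ∈ levelAbove (F.erase A₀) A k ∪
      (Finset.univ.filter fun S : Finset α => S.card = k ∧ A ⊆ S),
      S.card = k ∧ ∃ B ∈ F, B ⊆ S := by
    intro S hS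
    rcases Finset.mem_union.1 hS with h | h
    · obtain ⟨hc, -, B, hB, hBS⟩ := mem_levelAbove.1 h
      exact ⟨hc, B, Finset.mem_of_mem_erase hB, hBS⟩
    · obtain ⟨-, hc, hAS⟩ := Finset.mem_filter.1 h
      exact ⟨hc, A₀, hA₀, hAA.trans hAS⟩
  have h3 := erdos_ko_rado_fintype (F := levelAbove (F.erase A₀) A k ∪
      (Finset.univ.filter fun S : Finset α => S.card = k ∧ A ⊆ S)) (r := k) ?_ ?_ hk.le
  · rw [Finset.card_union_of_disjoint hdisj] at h3
    have := Finset.card_pos.2 ⟨A₀, hA₀⟩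
    omega
  · intro S hS T hT hST
    obtain ⟨-, B, hB, hBS⟩ := hsup S hS
    obtain ⟨-, D, hD, hDT⟩ := hsup T hT
    exact hint hB hD (Finset.disjoint_of_subset_left hBS (Finset.disjoint_of_subset_right hDT hST))
  · exact fun S hS => (hsup S hS).1

end SetFamilies

section IndependentFamilies

variable {ρ ι : Type}

/-- Any `t` members of the family cut the ground set into `2 ^ t` nonempty cells. -/
def IsIndependentFamily (t : ℕ) (A : ι → Finset ρ) : Prop :=
  ∀ cols : Fin t → ι, Function.Injective cols →
    ∀ v : Fin t → Prop, ∃ r, ∀ j, (r ∈ A (cols j) ↔ v j)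

theorem IsIndependentFamily.pair {A : ι → Finset ρ} (h : IsIndependentFamily 2 A) {i j : ι}
    (hij : i ≠ j) (a b : Prop) : ∃ r, (r ∈ A i ↔ a) ∧ (r ∈ A j ↔ b) := by
  obtain ⟨r, hr⟩ := h ![i, j] (by
    intro x y hxy
    fin_cases x <;> fin_cases y <;> simp_all) ![a, b]
  exact ⟨r, by simpa using hr 0, by simpa using hr 1⟩

theorem IsIndependentFamily.triple {A : ι → Finset ρ} (h : IsIndependentFamily 3 A) {i j l : ι}
    (hij : i ≠ j) (hil : i ≠ l) (hjl : j ≠ l) (a b c : Prop) :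
    ∃ r, (r ∈ A i ↔ a) ∧ (r ∈ A j ↔ b) ∧ (r ∈ A l ↔ c) := by
  obtain ⟨r, hr⟩ := h ![i, j, l] (by
    intro x y hxy
    fin_cases x <;> fin_cases y <;> simp_all) ![a, b, c]
  exact ⟨r, by simpa using hr 0, by simpa using hr 1, by simpa using hr 2⟩

/-- The other members of a family restricted to its member with index `i`. -/
def traceFamily [DecidableEq ρ] (A : ι → Finset ρ) (i : ι) :
    {j // j ≠ i} → Finset {r // r ∈ A i} :=
  fun j => (A j).subtype (· ∈ A i)

theorem card_traceFamily [DecidableEq ρ] (A : ι → Finset ρ) (i : ι) (j : {j // j ≠ i}) :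
    (traceFamily A i j).card = (A i ∩ A j).card := by
  rw [traceFamily, Finset.card_subtype, Finset.filter_mem_eq_inter, Finset.inter_comm]

theorem IsIndependentFamily.trace [DecidableEq ρ] {t : ℕ} {A : ι → Finset ρ}
    (h : IsIndependentFamily (t + 1) A) (i : ι) : IsIndependentFamily t (traceFamily A i) := by
  intro cols hcols v
  obtain ⟨r, hr⟩ := h (Fin.cons i fun j => (cols j : ι)) (by
    rw [Fin.cons_injective_iff]
    refine ⟨?_, Subtype.val_injective.comp hcols⟩
    rintro ⟨j, hj⟩
    exact (cols j).2 hj) (Fin.cons True v)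
  refine ⟨⟨r, by simpa using hr 0⟩, fun j => ?_⟩
  simpa [traceFamily] using hr j.succ

variable [Fintype ρ] [DecidableEq ρ]

/-- The family with the members selected by `f` replaced by their complements. -/
def flipFamily (f : ι → Prop) [DecidablePred f] (A : ι → Finset ρ) : ι → Finset ρ :=
  fun i => if f i then (A i)ᶜ else A i

theorem IsIndependentFamily.flip {t : ℕ} {A : ι → Finset ρ} (h : IsIndependentFamily t A)
    (f : ι → Prop) [DecidablePred f] : IsIndependentFamily t (flipFamily f A) := by
  intro cols hcols v
  obtain ⟨r, hr⟩ := h cols hcols fun j => if f (cols j) then ¬ v j else v j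
  refine ⟨r, fun j => ?_⟩
  have := hr j
  by_cases hf : f (cols j) <;> simp_all [flipFamily]

theorem card_flipFamily (f : ι → Prop) [DecidablePred f] (A : ι → Finset ρ) (i : ι) :
    (flipFamily f A i).card = if f i then Fintype.card ρ - (A i).card else (A i).card := by
  unfold flipFamily
  split_ifs
  · exact Finset.card_compl _
  · rfl

variable [Fintype ι]

theorem IsIndependentFamily.uniform_or_card_add_le {A : ι → Finset ρ}
    (h : IsIndependentFamily 2 A) (hι : 2 ≤ Fintype.card ι) :
    ((∀ i, (A i).card = Fintype.card ρ / 2 ∨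
        (A i).card = Fintype.card ρ - Fintype.card ρ / 2) ∧
      Fintype.card ι ≤ (Fintype.card ρ - 1).choose (Fintype.card ρ / 2 - 1)) ∨
    Fintype.card ι + (Fintype.card ρ - Fintype.card ρ / 2) ≤
      (Fintype.card ρ - 1).choose (Fintype.card ρ / 2 - 1) := by
  classical
  set k := Fintype.card ρ / 2 with hk
  have hB := h.flip fun i => k < (A i).card
  have hcard := card_flipFamily (fun i => k < (A i).card) A
  set B := flipFamily (fun i => k < (A i).card) A
  have hsize : ∀ i, (B i).card ≤ k := by
    intro i
    rw [hcard]
    split_ifs <;> omega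
  have hsub : ∀ i j, i ≠ j → ¬ B i ⊆ B j := by
    intro i j hij hs
    obtain ⟨r, h1, h2⟩ := hB.pair hij True False
    exact h2.1 (hs (h1.2 trivial))
  have hinj : Function.Injective B := by
    intro i j hij
    by_contra hne
    exact hsub i j hne hij.subset
  have hmeet : ∀ i j, ¬ Disjoint (B i) (B j) := by
    intro i j
    rw [Finset.not_disjoint_iff]
    by_cases hij : i = j
    · subst hij
      have : Nontrivial ι := Fintype.one_lt_card_iff_nontrivial.1 hι
      obtain ⟨j, hj⟩ := exists_ne i
      obtain ⟨r, h1, -⟩ := hB.pair hj.symm True True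
      exact ⟨r, h1.2 trivial, h1.2 trivial⟩
    · obtain ⟨r, h1, h2⟩ := hB.pair hij True True
      exact ⟨r, h1.2 trivial, h2.2 trivial⟩
  have hF : (Finset.univ.image B).card = Fintype.card ι := by
    rw [Finset.card_image_of_injective _ hinj, Finset.card_univ]
  have hint : ((Finset.univ.image B : Finset (Finset ρ)) : Set (Finset ρ)).Intersecting := by
    intro S hS T hT
    simp only [Finset.coe_image, Finset.coe_univ, Set.image_univ, Set.mem_range] at hS hT
    obtain ⟨i, rfl⟩ := hS
    obtain ⟨j, rfl⟩ := hT
    exact hmeet i j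
  rw [← hF]
  have hanti : IsAntichain (· ⊆ ·) ((Finset.univ.image B : Finset (Finset ρ)) : Set (Finset ρ)) := by
    intro S hS T hT hne
    simp only [Finset.coe_image, Finset.coe_univ, Set.image_univ, Set.mem_range] at hS hT
    obtain ⟨i, rfl⟩ := hS
    obtain ⟨j, rfl⟩ := hT
    exact hsub i j fun hij => hne (congrArg B hij)
  rcases hanti.uniform_or_card_add_le hint hk (by simpa using hsize) with hun | hle
  · left
    refine ⟨fun i => ?_, erdos_ko_rado_fintype hint (fun S hS => hun S hS) le_rfl⟩
    have h1 := hun (B i) (Finset.mem_image_of_mem _ (Finset.mem_univ i))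
    have h2 := Finset.card_le_univ (A i)
    rw [hcard] at h1
    split_ifs at h1 <;> omega
  · exact Or.inr hle

end IndependentFamilies

section Gram

variable {ρ ι : Type} [Fintype ρ] [Fintype ι]

theorem card_mul_sq_le_sum_sq_inner (v : ι → ρ → ℤ) (hv : ∀ i r, v i r * v i r = 1) :
    (Fintype.card ρ : ℤ) * (Fintype.card ι : ℤ) ^ 2 ≤
      ∑ i, ∑ j, (∑ r, v i r * v j r) ^ 2 := by
  have hswap : ∑ i, ∑ j, (∑ r, v i r * v j r) ^ 2 = ∑ r, ∑ s, (∑ i, v i r * v i s) ^ 2 := by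
    simp only [sq, Finset.sum_mul_sum]
    calc ∑ i, ∑ j, ∑ r, ∑ s, v i r * v j r * (v i s * v j s)
        = ∑ i, ∑ r, ∑ s, ∑ j, v i r * v j r * (v i s * v j s) := by
          refine Finset.sum_congr rfl fun i _ => ?_
          rw [Finset.sum_comm]
          exact Finset.sum_congr rfl fun r _ => Finset.sum_comm
      _ = ∑ r, ∑ s, ∑ i, ∑ j, v i r * v j r * (v i s * v j s) := by
          rw [Finset.sum_comm]
          exact Finset.sum_congr rfl fun r _ => Finset.sum_comm
      _ = _ := by
          refine Finset.sum_congr rfl fun r _ => Finset.sum_congr rfl fun s _ =>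
            Finset.sum_congr rfl fun i _ => Finset.sum_congr rfl fun j _ => by ring
  rw [hswap]
  calc (Fintype.card ρ : ℤ) * (Fintype.card ι : ℤ) ^ 2
      = ∑ r : ρ, (∑ i, v i r * v i r) ^ 2 := by simp [hv]
    _ ≤ _ := Finset.sum_le_sum fun r _ =>
        Finset.single_le_sum (f := fun s => (∑ i, v i r * v i s) ^ 2)
          (fun s _ => sq_nonneg _) (Finset.mem_univ r)

variable [DecidableEq ρ] [DecidableEq ι]

theorem sum_sign_mul_sign (S T : Finset ρ) :
    ∑ r, (if r ∈ S then (1 : ℤ) else -1) * (if r ∈ T then (1 : ℤ) else -1) =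
      Fintype.card ρ - 2 * S.card - 2 * T.card + 4 * (S ∩ T).card := by
  have h : ∀ r, (if r ∈ S then (1 : ℤ) else -1) * (if r ∈ T then (1 : ℤ) else -1) =
      1 - 2 * (if r ∈ S then 1 else 0) - 2 * (if r ∈ T then 1 else 0) +
        4 * (if r ∈ S ∩ T then 1 else 0) := by
    intro r
    by_cases hS : r ∈ S <;> by_cases hT : r ∈ T <;> simp [hS, hT]
  simp only [h, Finset.sum_add_distrib, Finset.sum_sub_distrib, ← Finset.mul_sum,
    Finset.sum_ite_mem, Finset.univ_inter, Finset.sum_const, Finset.card_univ]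
  simp

/-- A family of `m`-sets whose `±1` vectors are pairwise almost orthogonal is small. -/
theorem card_mul_le_of_inner_sq_le (A : ι → Finset ρ) (m : ℕ) (s : ℤ) (hA : ∀ i, (A i).card = m)
    (hs : ∀ i j, i ≠ j →
      ((Fintype.card ρ : ℤ) - 4 * m + 4 * (A i ∩ A j).card) ^ 2 ≤ s) [Nonempty ι] :
    (Fintype.card ρ : ℤ) * Fintype.card ι ≤
      (Fintype.card ρ : ℤ) ^ 2 + s * (Fintype.card ι - 1) := by
  have h1 := card_mul_sq_le_sum_sq_inner (fun i r => if r ∈ A i then (1 : ℤ) else -1)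
    (fun i r => by by_cases h : r ∈ A i <;> simp [h])
  simp only [sum_sign_mul_sign, hA] at h1
  have h2 : ∀ i j, ((Fintype.card ρ : ℤ) - 2 * m - 2 * m + 4 * (A i ∩ A j).card) ^ 2 ≤
      s + if i = j then (Fintype.card ρ : ℤ) ^ 2 - s else 0 := by
    intro i j
    by_cases hij : i = j
    · subst hij
      simp only [Finset.inter_self, hA, if_true]
      apply le_of_eq
      ring
    · have := hs i j hij
      rw [if_neg hij]
      convert this using 1 <;> ring
  have h3 := h1.trans (Finset.sum_le_sum fun i _ => Finset.sum_le_sum fun j _ => h2 i j)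
  simp only [Finset.sum_add_distrib, Finset.sum_ite_eq, Finset.mem_univ, if_true,
    Finset.sum_const, Finset.card_univ, nsmul_eq_mul] at h3
  have hpos : (0 : ℤ) < Fintype.card ι := by exact_mod_cast Fintype.card_pos
  nlinarith

end Gram

section Binomial

theorem choose_le_choose_of_le_half {a b n : ℕ} (hab : a ≤ b) (hb : b ≤ n / 2) :
    n.choose a ≤ n.choose b := by
  induction b, hab using Nat.le_induction with
  | base => exact le_rfl
  | succ b _ ih => exact (ih (by omega)).trans (Nat.choose_le_succ_of_lt_half_left (by omega))

theorem monotone_choose_half : Monotone fun h : ℕ => (h - 1).choose (h / 2 - 1) := by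
  refine monotone_nat_of_le_succ fun h => ?_
  rcases Nat.lt_or_ge h 2 with hh | hh
  · interval_cases h <;> simp
  · have h1 : h + 1 - 1 = (h - 1) + 1 := by omega
    rcases Nat.even_or_odd' h with ⟨k, rfl | rfl⟩
    · have h2 : (2 * k + 1) / 2 - 1 = 2 * k / 2 - 1 := by omega
      simp only [h2]
      exact Nat.choose_le_choose _ (by omega)
    · have h2 : (2 * k + 1 + 1) / 2 - 1 = ((2 * k + 1) / 2 - 1) + 1 := by omega
      simp only [h1, h2]
      rw [Nat.choose_succ_succ]
      exact Nat.le_add_right _ _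

theorem choose_half_add_le {m h : ℕ} (hm : 7 ≤ m) (hh : h < m) :
    (h - 1).choose (h / 2 - 1) + 3 * (m / 2) ≤ (m - 1).choose (m / 2 - 1) + m := by
  have hmono := monotone_choose_half (show h ≤ m - 1 by omega)
  simp only at hmono
  refine (Nat.add_le_add_right hmono _).trans ?_
  rcases Nat.even_or_odd' m with ⟨k, rfl | rfl⟩
  · obtain ⟨j, rfl⟩ : ∃ j, k = j + 2 := ⟨k - 2, by omega⟩
    have e1 : 2 * (j + 2) - 1 - 1 = 2 * j + 2 := by omega
    have e2 : (2 * (j + 2) - 1) / 2 - 1 = j := by omega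
    have e3 : 2 * (j + 2) - 1 = 2 * j + 2 + 1 := by omega
    have e4 : 2 * (j + 2) / 2 - 1 = j + 1 := by omega
    rw [e1, e2, e3, e4, Nat.choose_succ_succ' (2 * j + 2) j]
    have := choose_le_choose_of_le_half (a := 1) (b := j + 1) (n := 2 * j + 2)
      (by omega) (by omega)
    rw [Nat.choose_one_right] at this
    omega
  · obtain ⟨j, rfl⟩ : ∃ j, k = j + 2 := ⟨k - 2, by omega⟩
    have e1 : 2 * (j + 2) + 1 - 1 - 1 = 2 * j + 3 := by omega
    have e2 : (2 * (j + 2) + 1 - 1) / 2 - 1 = j + 1 := by omega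
    have e3 : 2 * (j + 2) + 1 - 1 = 2 * j + 3 + 1 := by omega
    have e4 : (2 * (j + 2) + 1) / 2 - 1 = j + 1 := by omega
    rw [e1, e2, e3, e4, Nat.choose_succ_succ' (2 * j + 3) j]
    have := choose_le_choose_of_le_half (a := 1) (b := j) (n := 2 * j + 3)
      (by omega) (by omega)
    rw [Nat.choose_one_right] at this
    omega

theorem mul_le_choose {a n : ℕ} (ha : 2 ≤ a) (han : a ≤ n / 2) :
    n * (n - 1) ≤ 2 * n.choose a := by
  have h := choose_le_choose_of_le_half ha han
  rw [Nat.choose_two_right] at h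
  have h3 : 2 ∣ n * (n - 1) := (Nat.even_mul_pred_self n).two_dvd
  omega

end Binomial

section Triples

variable {α κ : Type} [Fintype α]

theorem sum_affine_mul_affine (x y : α → ℤ) (a b c d : ℤ) :
    ∑ p, (a * x p + b) * (c * y p + d) =
      a * c * ∑ p, x p * y p + a * d * ∑ p, x p + b * c * ∑ p, y p + b * d * Fintype.card α := by
  have h : ∀ p, (a * x p + b) * (c * y p + d) =
      a * c * (x p * y p) + a * d * x p + b * c * y p + b * d := fun p => by ring
  simp only [h, Finset.sum_add_distrib, ← Finset.mul_sum, Finset.sum_const, Finset.card_univ,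
    nsmul_eq_mul]
  ring

variable [DecidableEq α] [Fintype κ]

/-- The part of the pair indicator of a triple in a `7`-set that is orthogonal to the constants
and to the point degrees. -/
def triplePairTensor (B : Finset α) (p q : α) : ℤ :=
  if p = q then 0 else
    (5 * (if p ∈ B then 1 else 0) - 2) * (if q ∈ B then 1 else 0) +
      (1 - 2 * (if p ∈ B then 1 else 0))

theorem sum_triplePairTensor_mul (hα : Fintype.card α = 7) (B D : Finset α) (hB : B.card = 3)
    (hD : D.card = 3) :
    ∑ p, ∑ q, triplePairTensor B p q * triplePairTensor D p q =
      5 * ((5 * ((B ∩ D).card : ℤ) - 3) * (((B ∩ D).card : ℤ) - 2)) := by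
  set x : α → ℤ := fun p => if p ∈ B then 1 else 0 with hx
  set y : α → ℤ := fun p => if p ∈ D then 1 else 0 with hy
  have sx : ∑ p, x p = 3 := by simp [hx, hB]
  have sy : ∑ p, y p = 3 := by simp [hy, hD]
  have sxy : ∑ p, x p * y p = (B ∩ D).card := by
    simp [hx, hy, Finset.inter_comm]
  have hxx : ∀ p, x p * x p = x p := fun p => by by_cases h : p ∈ B <;> simp [hx, h]
  have hyy : ∀ p, y p * y p = y p := fun p => by by_cases h : p ∈ D <;> simp [hy, h]
  have hterm : ∀ p q, triplePairTensor B p q * triplePairTensor D p q =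
      ((5 * x p - 2) * x q + (1 - 2 * x p)) * ((5 * y p - 2) * y q + (1 - 2 * y p)) -
        if p = q then (1 * x p + 1) * (1 * y p + 1) else 0 := by
    intro p q
    by_cases hpq : p = q
    · subst hpq
      simp only [triplePairTensor, if_true]
      have e1 : (5 * x p - 2) * x p + (1 - 2 * x p) = 1 * x p + 1 := by linear_combination 5 * hxx p
      have e2 : (5 * y p - 2) * y p + (1 - 2 * y p) = 1 * y p + 1 := by linear_combination 5 * hyy p
      rw [e1, e2]
      ring
    · simp only [triplePairTensor, if_neg hpq, sub_zero, hx, hy]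
  simp only [hterm, Finset.sum_sub_distrib, Finset.sum_ite_eq, Finset.mem_univ, if_true]
  rw [sum_affine_mul_affine x y 1 1 1 1]
  simp only [sum_affine_mul_affine x y, sx, sy, sxy, hα]
  set a : ℤ := ((B ∩ D).card : ℤ)
  have hq : ∀ p, (5 * x p - 2) * (5 * y p - 2) * a + (5 * x p - 2) * (1 - 2 * y p) * 3 +
      (1 - 2 * x p) * (5 * y p - 2) * 3 + (1 - 2 * x p) * (1 - 2 * y p) * ((7 : ℕ) : ℤ) =
      (25 * a - 32) * (x p * y p) + (13 - 10 * a) * x p + (13 - 10 * a) * y p + (4 * a - 5) := by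
    intro p
    push_cast
    ring
  simp only [hq, Finset.sum_add_distrib, ← Finset.mul_sum, Finset.sum_const, Finset.card_univ,
    nsmul_eq_mul, sx, sy, sxy, hα]
  push_cast
  ring

theorem sum_inter_triples_nonneg (hα : Fintype.card α = 7) (B : κ → Finset α)
    (hB : ∀ l, (B l).card = 3) :
    0 ≤ ∑ l, ∑ l', (5 * ((B l ∩ B l').card : ℤ) - 3) * (((B l ∩ B l').card : ℤ) - 2) := by
  have h : ∑ p, ∑ q, (∑ l, triplePairTensor (B l) p q) ^ 2 =
      5 * ∑ l, ∑ l', (5 * ((B l ∩ B l').card : ℤ) - 3) * (((B l ∩ B l').card : ℤ) - 2) := by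
    simp only [sq, Finset.sum_mul_sum]
    simp only [Finset.mul_sum (a := (5 : ℤ)),
      ← sum_triplePairTensor_mul hα _ _ (hB _) (hB _)]
    calc ∑ p, ∑ q, ∑ l, ∑ l', triplePairTensor (B l) p q * triplePairTensor (B l') p q
        = ∑ p, ∑ l, ∑ l', ∑ q, triplePairTensor (B l) p q * triplePairTensor (B l') p q := by
          refine Finset.sum_congr rfl fun p _ => ?_
          rw [Finset.sum_comm]
          exact Finset.sum_congr rfl fun l _ => Finset.sum_comm
      _ = _ := by
          rw [Finset.sum_comm]
          exact Finset.sum_congr rfl fun l _ => Finset.sum_comm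
  have h2 : 0 ≤ ∑ p, ∑ q, (∑ l, triplePairTensor (B l) p q) ^ 2 :=
    Finset.sum_nonneg fun p _ => Finset.sum_nonneg fun q _ => sq_nonneg _
  linarith

end Triples

section StrengthThree

variable {ρ ι : Type} [Fintype ρ] [DecidableEq ρ] [Fintype ι] [DecidableEq ι]

omit [Fintype ρ] [Fintype ι] [DecidableEq ι] in
theorem card_traceFamily_inter (A : ι → Finset ρ) (i : ι) (j l : {j // j ≠ i}) :
    (traceFamily A i j ∩ traceFamily A i l).card = (A i ∩ (A j ∩ A l)).card := by
  have : traceFamily A i j ∩ traceFamily A i l = (A j ∩ A l).subtype (· ∈ A i) := by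
    ext r
    simp [traceFamily]
  rw [this, Finset.card_subtype, Finset.filter_mem_eq_inter, Finset.inter_comm]

theorem card_inter_compl_add (X Y Z : Finset ρ) :
    (Xᶜ ∩ (Yᶜ ∩ Zᶜ)).card + (X.card + Y.card + Z.card + (X ∩ (Y ∩ Z)).card) =
      Fintype.card ρ + ((X ∩ Y).card + (X ∩ Z).card + (Y ∩ Z).card) := by
  have h1 := Finset.card_union_add_card_inter X Y
  have h2 := Finset.card_union_add_card_inter (X ∪ Y) Z
  have h3 := Finset.card_union_add_card_inter (X ∩ Z) (Y ∩ Z)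
  have h4 := Finset.card_add_card_compl (X ∪ Y ∪ Z)
  have e1 : (X ∪ Y) ∩ Z = X ∩ Z ∪ Y ∩ Z := Finset.union_inter_distrib_right X Y Z
  have e2 : X ∩ Z ∩ (Y ∩ Z) = X ∩ (Y ∩ Z) := by
    ext r
    simp only [Finset.mem_inter]
    tauto
  have e3 : (X ∪ Y ∪ Z)ᶜ = Xᶜ ∩ (Yᶜ ∩ Zᶜ) := by
    ext r
    simp only [Finset.mem_compl, Finset.mem_union, Finset.mem_inter]
    tauto
  rw [e1] at h2
  rw [e2] at h3
  rw [e3] at h4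
  omega

/-- The number of columns is so large that a strength-two array on `m` rows is nearly extremal. -/
def NearMaximal (m n : ℕ) : Prop :=
  7 ≤ m ∧ (m - 1).choose (m / 2 - 1) + m < n + 3 * (m / 2)

omit [DecidableEq ι] in
theorem NearMaximal.le_card {m n : ℕ} (hmn : NearMaximal m n) {A : ι → Finset ρ}
    (hA : IsIndependentFamily 2 A) (hn : Fintype.card ι = n) (hn2 : 2 ≤ n) :
    m ≤ Fintype.card ρ := by
  by_contra! hlt
  have h1 := choose_half_add_le hmn.1 hlt
  have h2 := hmn.2
  rcases hA.uniform_or_card_add_le (by omega) with h | h <;> omega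

omit [DecidableEq ι] in
theorem NearMaximal.card_eq {m n : ℕ} (hmn : NearMaximal m n) {A : ι → Finset ρ}
    (hA : IsIndependentFamily 2 A) (hn : Fintype.card ι = n) (hn2 : 2 ≤ n)
    (hm : Fintype.card ρ = m) (i : ι) : (A i).card = m / 2 ∨ (A i).card = m - m / 2 := by
  have h2 := hmn.2
  rcases hA.uniform_or_card_add_le (by omega) with h | h
  · simpa [hm] using h.1 i
  · rw [hm] at h
    omega

variable {m n : ℕ} (hmn : NearMaximal m n) (hn : Fintype.card ι = n + 1) (hn2 : 2 ≤ n)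
  {A : ι → Finset ρ} (hA : IsIndependentFamily 3 A)

include hmn hn hn2 hA

omit [Fintype ρ] in
theorem NearMaximal.le_card_member (i : ι) : m ≤ (A i).card := by
  have := hmn.le_card (hA.trace i) (by simp [hn]) hn2
  simpa using this

theorem NearMaximal.le_card_compl_member (i : ι) : m ≤ (A i)ᶜ.card := by
  have := hmn.le_card_member hn hn2 (hA.flip fun _ => True) i
  simpa [flipFamily] using this

omit [Fintype ρ] in
theorem NearMaximal.card_inter {i j : ι} (hij : j ≠ i) (hi : (A i).card = m) :
    (A i ∩ A j).card = m / 2 ∨ (A i ∩ A j).card = m - m / 2 := by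
  have := hmn.card_eq (hA.trace i) (by simp [hn]) hn2 (by simpa using hi) ⟨j, hij⟩
  rwa [card_traceFamily] at this

theorem NearMaximal.lt_card_of_odd (hm : Odd m) (hm9 : 9 ≤ m) : 2 * m < Fintype.card ρ := by
  by_contra! hle
  have hne : Nonempty ι := Fintype.card_pos_iff.1 (by omega)
  have hw : ∀ i, Fintype.card ρ = 2 * m ∧ (A i).card = m := by
    intro i
    have h1 := hmn.le_card_member hn hn2 hA i
    have h2 := hmn.le_card_compl_member hn hn2 hA i
    have h3 := Finset.card_add_card_compl (A i)
    omega
  have hρ := (hw (Classical.arbitrary ι)).1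
  have hgram := card_mul_le_of_inner_sq_le A m 4 (fun i => (hw i).2) (by
    intro i j hij
    obtain ⟨k, rfl⟩ := hm
    have := hmn.card_inter hn hn2 hA hij.symm (hw i).2
    have h : (A i ∩ A j).card = k ∨ (A i ∩ A j).card = k + 1 := by omega
    rw [hρ]
    rcases h with h | h <;> rw [h] <;> push_cast <;> apply le_of_eq <;> ring)
  obtain ⟨k, rfl⟩ := hm
  have hlow := mul_le_choose (a := (2 * k + 1) / 2 - 1) (n := 2 * k + 1 - 1) (by omega) (by omega)
  have h2 := hmn.2
  have e1 : (2 * k + 1) / 2 = k := by omega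
  have e2 : 2 * k + 1 - 1 = 2 * k := by omega
  rw [e1, e2] at h2 hlow
  rw [hρ, hn] at hgram
  obtain ⟨j, rfl⟩ : ∃ j, k = j + 4 := ⟨k - 4, by omega⟩
  have e3 : 2 * (j + 4) - 1 = 2 * j + 7 := by omega
  rw [e3] at hlow
  have h5 : 2 * (j + 4) * (2 * j + 7) < 2 * n + 2 * (j + 4) := by omega
  push_cast at hgram
  zify at h5
  nlinarith

theorem NearMaximal.lt_card_of_even (hm : Even m) : 2 * m + 1 < Fintype.card ρ := by
  by_contra! hle
  have hne : Nonempty ι := Fintype.card_pos_iff.1 (by omega)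
  have hρ : 2 * m ≤ Fintype.card ρ := by
    have h1 := hmn.le_card_member hn hn2 hA (Classical.arbitrary ι)
    have h2 := hmn.le_card_compl_member hn hn2 hA (Classical.arbitrary ι)
    have h3 := Finset.card_add_card_compl (A (Classical.arbitrary ι))
    omega
  have hB := hA.flip fun i => m < (A i).card
  have hcard := card_flipFamily (fun i => m < (A i).card) A
  set B := flipFamily (fun i => m < (A i).card) A
  have hw : ∀ i, (B i).card = m := by
    intro i
    have h1 := hmn.le_card_member hn hn2 hB i
    have h2 := hcard i
    split_ifs at h2 <;> omega
  have hgram := card_mul_le_of_inner_sq_le B m 1 hw (by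
    intro i j hij
    obtain ⟨k, rfl⟩ := hm
    have := hmn.card_inter hn hn2 hB hij.symm (hw i)
    have h : (B i ∩ B j).card = k := by omega
    have h' : Fintype.card ρ = 2 * (k + k) ∨ Fintype.card ρ = 2 * (k + k) + 1 := by omega
    rw [h]
    rcases h' with h' | h' <;> rw [h'] <;> push_cast <;> ring_nf <;> norm_num)
  have hm8 := hmn.1
  obtain ⟨k, rfl⟩ := hm
  obtain ⟨j, rfl⟩ : ∃ j, k = j + 4 := ⟨k - 4, by omega⟩
  have hlow := mul_le_choose (a := (j + 4 + (j + 4)) / 2 - 1) (n := j + 4 + (j + 4) - 1)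
    (by omega) (by omega)
  have h2 := hmn.2
  have e1 : (j + 4 + (j + 4)) / 2 = j + 4 := by omega
  have e2 : j + 4 + (j + 4) - 1 = 2 * j + 7 := by omega
  have e3 : 2 * j + 7 - 1 = 2 * j + 6 := by omega
  rw [e1, e2] at h2 hlow
  rw [e3] at hlow
  have h5 : (2 * j + 7) * (2 * j + 6) < 2 * n + 2 * (j + 4) := by omega
  rw [hn] at hgram
  have hupper : (n : ℤ) + 1 ≤ Fintype.card ρ + 1 := by
    push_cast at hgram
    by_contra! hlt
    have hpos : (1 : ℤ) < Fintype.card ρ := by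
      have : 1 < Fintype.card ρ := by omega
      exact_mod_cast this
    nlinarith
  zify at h5 hle
  nlinarith

end StrengthThree

section SevenRows

variable {ρ ι : Type} [Fintype ρ] [DecidableEq ρ] [Fintype ι] [DecidableEq ι]

omit [Fintype ρ] in
theorem sum_trace_triples_nonneg (A : ι → Finset ρ) (i : ι) (hi : (A i).card = 7)
    (hA : ∀ j, j ≠ i → (A i ∩ A j).card = 3) :
    0 ≤ ∑ l : {j // j ≠ i}, ∑ l' : {j // j ≠ i},
      (5 * ((A i ∩ (A l ∩ A l')).card : ℤ) - 3) * (((A i ∩ (A l ∩ A l')).card : ℤ) - 2) := by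
  have := sum_inter_triples_nonneg (by simpa using hi) (traceFamily A i)
    (fun l => by rw [card_traceFamily]; exact hA l l.2)
  simpa only [card_traceFamily_inter] using this

theorem card_le_of_weights_seven {A : ι → Finset ρ} (hA : IsIndependentFamily 3 A)
    (hρ : Fintype.card ρ = 14) (hw : ∀ i, (A i).card = 7) {i : ι}
    (hi : ∀ j, j ≠ i → (A i ∩ A j).card = 3)
    (hpair : ∀ j l, j ≠ l → (A j ∩ A l).card ≤ 4) : Fintype.card ι ≤ 14 := by
  have h1 := sum_trace_triples_nonneg A i (hw i) hi
  have hcompl : ∀ j, j ≠ i → ((A i)ᶜ ∩ (A j)ᶜ).card = 3 := by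
    intro j hj
    have h3 := Finset.card_union_add_card_inter (A i) (A j)
    have h4 := Finset.card_add_card_compl (A i ∪ A j)
    rw [← Finset.compl_union]
    rw [hi j hj, hw, hw] at h3
    omega
  have h2 := sum_trace_triples_nonneg (fun j => (A j)ᶜ) i
    (by rw [Finset.card_compl, hρ, hw]) hcompl
  have hbound : ∀ l l' : {j // j ≠ i},
      (5 * ((A i ∩ (A l ∩ A l')).card : ℤ) - 3) * (((A i ∩ (A l ∩ A l')).card : ℤ) - 2) +
      (5 * (((A i)ᶜ ∩ ((A l)ᶜ ∩ (A l')ᶜ)).card : ℤ) - 3) *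
        ((((A i)ᶜ ∩ ((A l)ᶜ ∩ (A l')ᶜ)).card : ℤ) - 2) ≤
      -2 + if l = l' then 26 else 0 := by
    intro l l'
    by_cases hll : l = l'
    · subst hll
      rw [Finset.inter_self, Finset.inter_self, hi l l.2, hcompl l l.2]
      norm_num
    · have hne : (l : ι) ≠ l' := fun h => hll (Subtype.ext h)
      have hsum := card_inter_compl_add (A i) (A l) (A l')
      rw [hi l l.2, hi l' l'.2, hw, hw, hw, hρ] at hsum
      have hle := hpair l l' hne
      have ha : 0 < (A i ∩ (A l ∩ A l')).card := by
        obtain ⟨r, h⟩ := hA.triple l.2.symm l'.2.symm hne True True True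
        exact Finset.card_pos.2 ⟨r, by simpa using h⟩
      have hb : 0 < ((A i)ᶜ ∩ ((A l)ᶜ ∩ (A l')ᶜ)).card := by
        obtain ⟨r, h⟩ := hA.triple l.2.symm l'.2.symm hne False False False
        exact Finset.card_pos.2 ⟨r, by simpa using h⟩
      rw [if_neg hll]
      have hcases : ((A i ∩ (A l ∩ A l')).card = 1 ∧
            ((A i)ᶜ ∩ ((A l)ᶜ ∩ (A l')ᶜ)).card = 1) ∨
          ((A i ∩ (A l ∩ A l')).card = 1 ∧ ((A i)ᶜ ∩ ((A l)ᶜ ∩ (A l')ᶜ)).card = 2) ∨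
          ((A i ∩ (A l ∩ A l')).card = 2 ∧ ((A i)ᶜ ∩ ((A l)ᶜ ∩ (A l')ᶜ)).card = 1) := by
        omega
      rcases hcases with h | h | h <;> rw [h.1, h.2] <;> norm_num
  have h3 := add_nonneg h1 h2
  simp only [← Finset.sum_add_distrib] at h3
  have h4 := h3.trans (Finset.sum_le_sum fun l _ => Finset.sum_le_sum fun l' _ => hbound l l')
  simp only [Finset.sum_add_distrib, Finset.sum_ite_eq, Finset.mem_univ, if_true,
    Finset.sum_const, Finset.card_univ, nsmul_eq_mul] at h4
  by_contra! hlt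
  have hc : 14 ≤ Fintype.card {j // j ≠ i} := by
    simp
    omega
  zify at hc
  nlinarith

theorem NearMaximal.lt_card_of_seven {n : ℕ} (hmn : NearMaximal 7 n)
    (hn : Fintype.card ι = n + 1) {A : ι → Finset ρ} (hA : IsIndependentFamily 3 A) :
    14 < Fintype.card ρ := by
  by_contra! hle
  have hn14 : 14 ≤ n := by
    have h : (7 - 1).choose (7 / 2 - 1) = 15 := by decide
    have := hmn.2
    omega
  have hn2 : 2 ≤ n := by omega
  have hne : Nonempty ι := Fintype.card_pos_iff.1 (by omega)
  have hw : ∀ {B : ι → Finset ρ}, IsIndependentFamily 3 B →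
      ∀ i, Fintype.card ρ = 14 ∧ (B i).card = 7 := by
    intro B hB i
    have h1 := hmn.le_card_member hn hn2 hB i
    have h2 := hmn.le_card_compl_member hn hn2 hB i
    have h3 := Finset.card_add_card_compl (B i)
    omega
  obtain ⟨i⟩ := hne
  have hρ := (hw hA i).1
  have hB := hA.flip fun j => j ≠ i ∧ (A i ∩ A j).card = 4
  have hBi : flipFamily (fun j => j ≠ i ∧ (A i ∩ A j).card = 4) A i = A i := by
    simp [flipFamily]
  have hpair : ∀ j l, j ≠ l →
      (flipFamily (fun j => j ≠ i ∧ (A i ∩ A j).card = 4) A j ∩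
        flipFamily (fun j => j ≠ i ∧ (A i ∩ A j).card = 4) A l).card ≤ 4 := by
    intro j l hjl
    rcases hmn.card_inter hn hn2 hB hjl.symm (hw hB j).2 with h | h <;> omega
  have h3 : ∀ j, j ≠ i → (flipFamily (fun j => j ≠ i ∧ (A i ∩ A j).card = 4) A i ∩
        flipFamily (fun j => j ≠ i ∧ (A i ∩ A j).card = 4) A j).card = 3 := by
    intro j hj
    rw [hBi]
    unfold flipFamily
    have h := hmn.card_inter hn hn2 hA hj (hw hA i).2
    split_ifs with hc
    · have h4 := Finset.card_sdiff_add_card_inter (A i) (A j)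
      rw [Finset.sdiff_eq_inter_compl] at h4
      have h5 := (hw hA i).2
      omega
    · have : (A i ∩ A j).card ≠ 4 := fun h => hc ⟨hj, h⟩
      omega
  have := card_le_of_weights_seven hB hρ (fun j => (hw hB j).2) h3 hpair
  omega

end SevenRows

section CoveringArrays

theorem mul_le_card_of_isIndependentFamily {L N : ℕ}
    (hbase : ∀ (ρ ι : Type) [Fintype ρ] [DecidableEq ρ] [Fintype ι] [DecidableEq ι]
      (A : ι → Finset ρ), Fintype.card ι = N → IsIndependentFamily 3 A → L ≤ Fintype.card ρ)
    (d : ℕ) : ∀ (ρ ι : Type) [Fintype ρ] [DecidableEq ρ] [Fintype ι] [DecidableEq ι]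
      (A : ι → Finset ρ), 0 < N → Fintype.card ι = N + d → IsIndependentFamily (3 + d) A →
      2 ^ d * L ≤ Fintype.card ρ := by
  induction d with
  | zero =>
    intro ρ ι _ _ _ _ A _ hι hA
    simpa using hbase ρ ι A hι hA
  | succ d ih =>
    intro ρ ι _ _ _ _ A hN hι hA
    obtain ⟨i⟩ : Nonempty ι := Fintype.card_pos_iff.1 (by omega)
    have hhalf : ∀ B : ι → Finset ρ, IsIndependentFamily (3 + (d + 1)) B →
        2 ^ d * L ≤ (B i).card := by
      intro B hB
      have := ih _ _ (traceFamily B i) hN (by simp [hι]) (hB.trace i)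
      simpa using this
    have h1 := hhalf A hA
    have h2 := hhalf _ (hA.flip fun _ => True)
    have h3 := Finset.card_add_card_compl (A i)
    simp only [flipFamily, if_true] at h2
    rw [pow_succ]
    linarith

theorem exists_isCoveringArray_CAN (t n q : ℕ) [NeZero q] :
    ∃ C : Fin (CAN t n q) → Fin n → Fin q, IsCoveringArray (CAN t n q) n q t C := by
  refine Nat.sInf_mem (s := { m | ∃ C : Fin m → Fin n → Fin q, IsCoveringArray m n q t C }) ?_
  let e := Fintype.equivFin (Fin n → Fin q)
  refine ⟨_, fun r => e.symm r, fun cols hcols v => ?_⟩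
  classical
  refine ⟨e fun c => if h : ∃ j, cols j = c then v h.choose else 0, fun j => ?_⟩
  have h : ∃ j', cols j' = cols j := ⟨j, rfl⟩
  simp only [Equiv.symm_apply_apply, dif_pos h]
  rw [hcols h.choose_spec]

theorem IsCoveringArray.isIndependentFamily {m n t : ℕ} {C : Fin m → Fin n → Fin 2}
    (hC : IsCoveringArray m n 2 t C) :
    IsIndependentFamily t fun i => Finset.univ.filter fun r => C r i = 1 := by
  classical
  intro cols hcols v
  obtain ⟨r, hr⟩ := hC cols hcols fun j => if v j then 1 else 0
  refine ⟨r, fun j => ?_⟩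
  rw [Finset.mem_filter, hr j]
  by_cases h : v j <;> simp [h]

end CoveringArrays

/-- for `m ≥ 7`, `t ≥ 3`, and
`binom(m-1,⌊m/2⌋-1) + m - 3⌊m/2⌋ < n ≤ binom(m-1,⌊m/2⌋-1)`,
`CAN(t, n+t-2, 2) ≥ 2^(t-3)·(2m+1)` if `m` is odd and
`CAN(t, n+t-2, 2) ≥ 2^(t-2)·(m+1)` if `m` is even. -/
theorem improved_roux_general (m t n : ℕ) (hm : 7 ≤ m) (ht : 3 ≤ t)
    (hn1 : (m-1).choose (m/2 - 1) + m < n + 3 * (m/2))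
    (hn2 : n ≤ (m-1).choose (m/2 - 1)) :
    (Odd m → 2^(t-3) * (2*m+1) ≤ CAN t (n+t-2) 2) ∧
    (Even m → 2^(t-2) * (m+1) ≤ CAN t (n+t-2) 2) := by
  have hmn : NearMaximal m n := ⟨hm, hn1⟩
  have hn3 : 2 ≤ n := by
    have h := choose_le_choose_of_le_half (a := 1) (b := m / 2 - 1) (n := m - 1)
      (by omega) (by omega)
    rw [Nat.choose_one_right] at h
    omega
  obtain ⟨d, rfl⟩ : ∃ d, t = 3 + d := ⟨t - 3, by omega⟩
  obtain ⟨C, hC⟩ := exists_isCoveringArray_CAN (3 + d) (n + (3 + d) - 2) 2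
  have key : ∀ L, (∀ (ρ ι : Type) [Fintype ρ] [DecidableEq ρ] [Fintype ι] [DecidableEq ι]
      (A : ι → Finset ρ), Fintype.card ι = n + 1 → IsIndependentFamily 3 A →
        L ≤ Fintype.card ρ) → 2 ^ d * L ≤ CAN (3 + d) (n + (3 + d) - 2) 2 := by
    intro L hL
    have := mul_le_card_of_isIndependentFamily hL d _ _ _ (Nat.succ_pos n)
      (by rw [Fintype.card_fin]; omega) hC.isIndependentFamily
    rwa [Fintype.card_fin] at this
  constructor
  · intro hodd
    rw [Nat.add_sub_cancel_left]
    refine key _ fun ρ ι _ _ _ _ A hι hA => ?_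
    rcases Nat.lt_or_ge m 9 with h9 | h9
    · obtain rfl : m = 7 := by
        obtain ⟨k, rfl⟩ := hodd
        omega
      exact hmn.lt_card_of_seven hι hA
    · exact hmn.lt_card_of_odd hι hn3 hA hodd h9
  · intro heven
    have h := key (2 * m + 2) fun ρ ι _ _ _ _ A hι hA =>
      hmn.lt_card_of_even hι hn3 hA heven
    have e : 3 + d - 2 = d + 1 := by omega
    rw [e, pow_succ]
    linarith
end

section
/- CAN(4,12,2) = 24, and the 24 × 12 binary 4-covering array is unique up to equivalence; that is, there exists a 24 × 12 binary 4-covering array, no 23 × 12 binary 4-covering array exists, and any two 24 × 12 binary 4-covering arrays are equivalent. -/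
open Finset

/-- The columns in `J`, restricted to the rows in `R`, form a 2-covering array. -/
def PairCovering {ι κ : Type*} (C : ι → κ → Fin 2) (R : Finset ι) (J : Finset κ) : Prop :=
  ∀ k ∈ J, ∀ l ∈ J, k ≠ l → ∀ u v, ∃ r ∈ R, C r k = u ∧ C r l = v

namespace PairCovering

variable {ι κ : Type*} {C : ι → κ → Fin 2} {R : Finset ι} {J : Finset κ}

theorem two_le_card (h : PairCovering C R J) (hJ : 1 < #J) {j : κ} (hj : j ∈ J) (u : Fin 2) :
    2 ≤ #{r ∈ R | C r j = u} := by
  obtain ⟨k, hk, hkj⟩ := exists_mem_ne hJ j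
  obtain ⟨r, hr, hru, hr0⟩ := h j hj k hk hkj.symm u 0
  obtain ⟨s, hs, hsu, hs1⟩ := h j hj k hk hkj.symm u 1
  refine one_lt_card.2 ⟨r, by simp [hr, hru], s, by simp [hs, hsu], ?_⟩
  rintro rfl
  simp [hr0] at hs1

/-- If some column takes a value on just two rows, the other columns are determined by an
antichain of subsets of the remaining rows, so Sperner's theorem applies. -/
theorem card_le_of_card_eq_two (h : PairCovering C R J) {j : κ} (hj : j ∈ J) {u : Fin 2}
    (hu : #{r ∈ R | C r j = u} = 2) : #J - 1 ≤ (#R - 2).choose ((#R - 2) / 2) := by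
  classical
  obtain ⟨a, b, hab, hS⟩ := card_eq_two.1 hu
  have hmem : ∀ r, (r ∈ R ∧ C r j = u) ↔ (r = a ∨ r = b) := fun r => by
    simpa using congrArg (r ∈ ·) hS
  have hne : ∀ k ∈ J.erase j, C a k ≠ C b k := by
    intro k hk heq
    obtain ⟨hkj, hkJ⟩ := mem_erase.1 hk
    obtain ⟨r, hr, hru, hrk⟩ := h j hj k hkJ hkj.symm u (C a k + 1)
    rcases (hmem r).1 ⟨hr, hru⟩ with rfl | rfl
    · simp at hrk
    · simp [heq] at hrk
  set T : κ → Finset ↥(R \ {a, b}) := fun k => {r | C r k = C a k} with hT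
  have hsub : ∀ k ∈ J.erase j, ∀ l ∈ J.erase j, T k ⊆ T l → k = l := by
    intro k hk l hl hkl
    by_contra hne'
    obtain ⟨r, hr, hrk, hrl⟩ :=
      h k (mem_of_mem_erase hk) l (mem_of_mem_erase hl) hne' (C a k) (C b l)
    have hra : r ≠ a := by rintro rfl; exact hne l hl hrl
    have hrb : r ≠ b := by rintro rfl; exact hne k hk hrk.symm
    have : (⟨r, by simp [hr, hra, hrb]⟩ : ↥(R \ {a, b})) ∈ T l := hkl (by simp [hT, hrk])
    simp only [hT, mem_filter, mem_univ, true_and] at this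
    exact hne l hl (this.symm.trans hrl)
  have hanti : IsAntichain (· ⊆ ·)
      (((J.erase j).image T : Finset _) : Set (Finset ↥(R \ {a, b}))) := by
    intro A hA B hB hAB hle
    obtain ⟨k, hk, rfl⟩ := mem_image.1 (mem_coe.1 hA)
    obtain ⟨l, hl, rfl⟩ := mem_image.1 (mem_coe.1 hB)
    exact hAB (congrArg T (hsub k hk l hl hle))
  have hcard := hanti.sperner
  rw [card_image_of_injOn fun k hk l hl hkl => hsub k hk l hl hkl.subset, card_erase_of_mem hj,
    Fintype.card_coe, card_sdiff_of_subset, card_pair hab] at hcard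
  · exact hcard
  · intro r hr
    exact ((hmem r).2 (by simpa using hr)).1

theorem card_filter_add_card_filter (R : Finset ι) (f : ι → Fin 2) (u : Fin 2) :
    #{r ∈ R | f r = u} + #{r ∈ R | f r = u + 1} = #R := by
  rw [← card_filter_add_card_filter_not (s := R) (fun r => f r = u)]
  congr 2
  refine filter_congr fun r _ => ?_
  generalize f r = v
  decide +revert

theorem card_filter_and_add_card_filter_and [Fintype ι] (P : ι → Prop) [DecidablePred P]
    (f : ι → Fin 2) (u : Fin 2) :
    #{r | P r ∧ f r = u} + #{r | P r ∧ f r = u + 1} = #{r | P r} := by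
  simpa [filter_filter] using card_filter_add_card_filter (univ.filter P) f u

theorem card_filter_and_and [Fintype ι] (P : ι → Prop) [DecidablePred P] (f g : ι → Fin 2)
    (u v : Fin 2) :
    #{r | P r ∧ f r = u ∧ g r = v} + #{r | P r ∧ f r = u ∧ g r = v + 1} +
      (#{r | P r ∧ f r = u + 1 ∧ g r = v} + #{r | P r ∧ f r = u + 1 ∧ g r = v + 1}) =
      #{r | P r} := by
  simp only [← filter_filter, card_filter_add_card_filter]

theorem six_le_card (h : PairCovering C R J) (hJ : 5 ≤ #J) : 6 ≤ #R := by
  by_contra! hR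
  obtain ⟨j, hj⟩ := card_pos.1 (show 0 < #J by lia)
  have h0 := h.two_le_card (by lia) hj 0
  have h1 := h.two_le_card (by lia) hj 1
  have hs := card_filter_add_card_filter R (C · j) 0
  simp only [zero_add] at hs
  have hle : #J - 1 ≤ (#R - 2).choose ((#R - 2) / 2) := by
    rcases (show #{r ∈ R | C r j = 0} = 2 ∨ #{r ∈ R | C r j = 1} = 2 by lia) with h2 | h2 <;>
      exact h.card_le_of_card_eq_two hj h2
  have : ∀ n < 4, n.choose (n / 2) < 4 := by decide
  have := this (#R - 2) (by lia)
  lia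

theorem card_eq_three (h : PairCovering C R J) (hJ : 8 ≤ #J) (hR : #R = 6) {j : κ} (hj : j ∈ J)
    (u : Fin 2) : #{r ∈ R | C r j = u} = 3 := by
  have h3 : ∀ v, 3 ≤ #{r ∈ R | C r j = v} := fun v => by
    by_contra! hlt
    have h2 := h.two_le_card (by lia) hj v
    have hle := h.card_le_of_card_eq_two hj (u := v) (by lia)
    rw [hR, show Nat.choose (6 - 2) ((6 - 2) / 2) = 6 by decide] at hle
    lia
  have := card_filter_add_card_filter R (C · j) u
  have := h3 u
  have := h3 (u + 1)
  lia

end PairCovering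

namespace IsCoveringArray

variable {m : ℕ} {C : Fin m → Fin 12 → Fin 2}

theorem exists_row (hC : IsCoveringArray m 12 2 4 C) {i j k l : Fin 12} (hij : i ≠ j)
    (hik : i ≠ k) (hil : i ≠ l) (hjk : j ≠ k) (hjl : j ≠ l) (hkl : k ≠ l) (a b c d : Fin 2) :
    ∃ r, C r i = a ∧ C r j = b ∧ C r k = c ∧ C r l = d := by
  obtain ⟨r, hr⟩ := hC ![i, j, k, l] (by
    intro x y
    fin_cases x <;> fin_cases y <;> simp_all [eq_comm]) ![a, b, c, d]
  exact ⟨r, hr 0, hr 1, hr 2, hr 3⟩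

theorem pairCovering (hC : IsCoveringArray m 12 2 4 C) {i j : Fin 12} (hij : i ≠ j)
    (a b : Fin 2) : PairCovering C {r | C r i = a ∧ C r j = b} (univ \ {i, j}) := by
  intro k hk l hl hkl u v
  simp only [mem_sdiff, mem_univ, mem_insert, mem_singleton, true_and, not_or] at hk hl
  obtain ⟨r, h1, h2, h3, h4⟩ := hC.exists_row hij (Ne.symm hk.1) (Ne.symm hl.1) (Ne.symm hk.2)
    (Ne.symm hl.2) hkl a b u v
  exact ⟨r, by simp [h1, h2], h3, h4⟩

theorem card_compl_pair {i j : Fin 12} (hij : i ≠ j) :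
    #(univ \ {i, j} : Finset (Fin 12)) = 10 := by
  rw [card_sdiff_of_subset (subset_univ _), card_pair hij]
  rfl

theorem six_le_card (hC : IsCoveringArray m 12 2 4 C) {i j : Fin 12} (hij : i ≠ j)
    (a b : Fin 2) : 6 ≤ #{r | C r i = a ∧ C r j = b} :=
  (hC.pairCovering hij a b).six_le_card (by rw [card_compl_pair hij]; lia)

theorem sum_card {i j : Fin 12} (C : Fin m → Fin 12 → Fin 2) (a b : Fin 2) :
    #{r | C r i = a ∧ C r j = b} + #{r | C r i = a ∧ C r j = b + 1} +
      (#{r | C r i = a + 1 ∧ C r j = b} + #{r | C r i = a + 1 ∧ C r j = b + 1}) = m := by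
  simpa using PairCovering.card_filter_and_and (fun _ => True) (C · i) (C · j) a b

theorem le_card_rows (hC : IsCoveringArray m 12 2 4 C) : 24 ≤ m := by
  have h := hC.six_le_card (i := 0) (j := 1) (by decide)
  have := sum_card (i := 0) (j := 1) C 0 0
  have := h 0 0
  have := h 0 (0 + 1)
  have := h (0 + 1) 0
  have := h (0 + 1) (0 + 1)
  lia

variable {C : Fin 24 → Fin 12 → Fin 2}

theorem card_eq_six (hC : IsCoveringArray 24 12 2 4 C) {i j : Fin 12} (hij : i ≠ j)
    (a b : Fin 2) : #{r | C r i = a ∧ C r j = b} = 6 := by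
  have h := hC.six_le_card hij
  have := sum_card (i := i) (j := j) C a b
  have := h a b
  have := h a (b + 1)
  have := h (a + 1) b
  have := h (a + 1) (b + 1)
  lia

/-- A 24 × 12 binary 4-covering array is an orthogonal array of strength 3. -/
theorem card_eq_three (hC : IsCoveringArray 24 12 2 4 C) {i j k : Fin 12} (hij : i ≠ j)
    (hik : i ≠ k) (hjk : j ≠ k) (a b c : Fin 2) :
    #{r | C r i = a ∧ C r j = b ∧ C r k = c} = 3 := by
  have := (hC.pairCovering hij a b).card_eq_three (by rw [card_compl_pair hij]; lia)
    (hC.card_eq_six hij a b) (j := k) (by simp [hik.symm, hjk.symm]) c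
  simpa [filter_filter, and_assoc] using this

end IsCoveringArray

/-- The four nonzero linear forms on the affine plane of order 3, up to sign. -/
def lineForm : Fin 2 × Fin 2 → Fin 3 × Fin 3 → Fin 3
  | (0, 0), s => s.1
  | (0, 1), s => s.2
  | (1, 0), s => s.1 + s.2
  | (1, 1), s => s.1 - s.2

theorem eq_add_of_injective_of_ne : ∀ g : Fin 3 → Fin 3, Function.Injective g →
    (∀ x, g x ≠ x) → ∀ x, g x = x + g 0 := by
  decide

/-- Let `L` be a map on the affine plane of order 3, with no two distinct points on a
horizontal or vertical line having the same image. Then `L` is, up to a permutation of the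
values, the map `(x, y) ↦ x + s y` with `s 0 = 0`. -/
theorem latin_normal_form (L : Fin 3 → Fin 3 → Fin 3) (h1 : ∀ y x x', L x y = L x' y → x = x')
    (h2 : ∀ x y y', L x y = L x y' → y = y') :
    ∃ (α : Equiv.Perm (Fin 3)) (s : Fin 3 → Fin 3), s 0 = 0 ∧ Function.Injective s ∧
      ∀ x y, L x y = α (x + s y) := by
  set α : Equiv.Perm (Fin 3) :=
    Equiv.ofBijective (fun x => L x 0) (Finite.injective_iff_bijective.1 fun x x' => h1 0 x x')
    with hα
  have hα' : ∀ x, α x = L x 0 := fun _ => rfl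
  have hα0 : ∀ x, α.symm (L x 0) = x := fun x => by rw [← hα', Equiv.symm_apply_apply]
  have key : ∀ x y, α.symm (L x y) = x + α.symm (L 0 y) := by
    intro x y
    by_cases hy : y = 0
    · subst hy
      rw [hα0, hα0, add_zero]
    · refine eq_add_of_injective_of_ne (fun x => α.symm (L x y))
        (fun x x' h => h1 y x x' (α.symm.injective h)) (fun x h => hy ?_) x
      exact h2 x y 0 (α.symm.injective (h.trans (hα0 x).symm))
  refine ⟨α, fun y => α.symm (L 0 y), hα0 0, fun y y' h => h2 0 y y' (α.symm.injective h),
    fun x y => ?_⟩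
  rw [← key, Equiv.apply_symm_apply]

/-- Nine ternary words of length 4 at pairwise distance at least 3 form a tetracode. -/
theorem exists_tetracode_coordinates (w : Fin 2 × Fin 2 → Fin 9 → Fin 3)
    (hw : ∀ p q, p ≠ q → ∀ k l, w p k = w p l → w q k = w q l → k = l) :
    ∃ κ : Fin 3 × Fin 3 ≃ Fin 9, ∀ q s t,
      w q (κ s) = w q (κ t) ↔ lineForm q s = lineForm q t := by
  have hbij : Function.Bijective fun k => (w (0, 0) k, w (0, 1) k) := by
    refine (Fintype.bijective_iff_injective_and_card _).2 ⟨fun k l h => ?_, by simp⟩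
    exact hw (0, 0) (0, 1) (by decide) k l (congrArg Prod.fst h) (congrArg Prod.snd h)
  set κ := (Equiv.ofBijective _ hbij).symm with hκ
  have hκ' : ∀ s, (w (0, 0) (κ s), w (0, 1) (κ s)) = s :=
    fun s => (Equiv.ofBijective _ hbij).apply_symm_apply s
  have hx : ∀ x y, w (0, 0) (κ (x, y)) = x := fun x y => congrArg Prod.fst (hκ' (x, y))
  have hy : ∀ x y, w (0, 1) (κ (x, y)) = y := fun x y => congrArg Prod.snd (hκ' (x, y))
  have h1 : ∀ z y x x', w (1, z) (κ (x, y)) = w (1, z) (κ (x', y)) → x = x' := by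
    intro z y x x' h
    have := hw (1, z) (0, 1) (by simp) _ _ h (by rw [hy, hy])
    simpa using this
  have h2 : ∀ z x y y', w (1, z) (κ (x, y)) = w (1, z) (κ (x, y')) → y = y' := by
    intro z x y y' h
    have := hw (1, z) (0, 0) (by simp) _ _ h (by rw [hx, hx])
    simpa using this
  obtain ⟨α, s, hs0, hs, hα⟩ := latin_normal_form (fun x y => w (1, 0) (κ (x, y))) (h1 0) (h2 0)
  obtain ⟨β, t, ht0, ht, hβ⟩ := latin_normal_form (fun x y => w (1, 1) (κ (x, y))) (h1 1) (h2 1)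
  have hst : ∀ y, t y = -s y := by
    intro y
    by_cases hy0 : y = 0
    · simp [hy0, hs0, ht0]
    have hs' : s y ≠ 0 := fun h => hy0 (hs (h.trans hs0.symm))
    have ht' : t y ≠ 0 := fun h => hy0 (ht (h.trans ht0.symm))
    have hne : s y ≠ t y := by
      intro h
      refine hy0 ?_
      have := hw (1, 0) (1, 1) (by decide) (κ (-s y, y)) (κ (0, 0))
        (by simp only [hα]; simp [hs0]) (by simp only [hβ]; simp [ht0, h])
      simpa using congrArg Prod.snd (κ.injective this)
    generalize s y = a at *
    generalize t y = b at *
    clear * - hs' ht' hne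
    decide +revert
  set σ : Equiv.Perm (Fin 3) := Equiv.ofBijective s (Finite.injective_iff_bijective.1 hs)
  have hσ : ∀ y, s (σ.symm y) = y := fun y => σ.apply_symm_apply y
  refine ⟨((Equiv.refl _).prodCongr σ.symm).trans κ, ?_⟩
  rintro ⟨u, v⟩ ⟨x, y⟩ ⟨x', y'⟩
  simp only [Equiv.trans_apply, Equiv.prodCongr_apply, Prod.map_apply, Equiv.refl_apply]
  fin_cases u <;> fin_cases v
  · simp [lineForm, hx]
  · simp [lineForm, hy]
  · simp [lineForm, hα, hσ]
  · simp [lineForm, hβ, hst, hσ, sub_eq_add_neg]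

/-- Up to equivalence, the only 24 × 12 binary 4-covering array. The rows are split into blocks
of three according to their entries in the first three columns; each of the other columns
has one exceptional entry in every block, at the place given by a linear form. -/
def tetracodeArray : (Fin 2 × Fin 2 × Fin 2) × Fin 3 → Fin 3 ⊕ (Fin 3 × Fin 3) → Fin 2
  | ((a, b, c), _), Sum.inl i => ![a, b, c] i
  | ((a, b, c), t), Sum.inr s =>
    if t = lineForm (a + b, a + c) s then a + b + c else a + b + c + 1

namespace IsCoveringArray

variable {C : Fin 24 → Fin 12 → Fin 2}

theorem exists_card_eq_one (hC : IsCoveringArray 24 12 2 4 C) (k : Fin 9) :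
    ∃ e : Fin 2, ∀ a b c,
      #{r | C r 0 = a ∧ C r 1 = b ∧ C r 2 = c ∧ C r (Fin.natAdd 3 k) = a + b + c + e} = 1 := by
  have h0 : (0 : Fin 12) ≠ Fin.natAdd 3 k := by revert k; decide
  have h1 : (1 : Fin 12) ≠ Fin.natAdd 3 k := by revert k; decide
  have h2 : (2 : Fin 12) ≠ Fin.natAdd 3 k := by revert k; decide
  generalize (Fin.natAdd 3 k : Fin 12) = l at *
  set n : Fin 2 → Fin 2 → Fin 2 → Fin 2 → ℕ :=
    fun a b c d => #{r | C r 0 = a ∧ C r 1 = b ∧ C r 2 = c ∧ C r l = d} with hn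
  have hpos : ∀ a b c d, 1 ≤ n a b c d := fun a b c d => by
    obtain ⟨r, hr⟩ := hC.exists_row (i := 0) (j := 1) (k := 2) (l := l) (by decide) (by decide) h0
      (by decide) h1 h2 a b c d
    exact card_pos.2 ⟨r, by simpa using hr⟩
  have hA : ∀ b c d, n 0 b c d + n 1 b c d = 3 := fun b c d => by
    rw [← hC.card_eq_three (i := 1) (j := 2) (k := l) (by decide) h1 h2 b c d,
      ← PairCovering.card_filter_and_add_card_filter_and _ (C · 0) 0]
    simp only [hn]
    congr 2 <;> (ext r; simp; tauto)
  have hB : ∀ a c d, n a 0 c d + n a 1 c d = 3 := fun a c d => by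
    rw [← hC.card_eq_three (i := 0) (j := 2) (k := l) (by decide) h0 h2 a c d,
      ← PairCovering.card_filter_and_add_card_filter_and _ (C · 1) 0]
    simp only [hn]
    congr 2 <;> (ext r; simp; tauto)
  have hc : ∀ a b d, n a b 0 d + n a b 1 d = 3 := fun a b d => by
    rw [← hC.card_eq_three (i := 0) (j := 1) (k := l) (by decide) h0 h1 a b d,
      ← PairCovering.card_filter_and_add_card_filter_and _ (C · 2) 0]
    simp only [hn]
    congr 2 <;> (ext r; simp; tauto)
  have hD : n 0 0 0 0 + n 0 0 0 1 = 3 := by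
    rw [← hC.card_eq_three (i := 0) (j := 1) (k := 2) (by decide) (by decide) (by decide) 0 0 0,
      ← PairCovering.card_filter_and_add_card_filter_and _ (C · l) 0]
    simp only [hn]
    congr 2 <;> (ext r; simp; tauto)
  have h11 : (1 : Fin 2) + 1 = 0 := by decide
  change ∃ e, ∀ a b c, n a b c (a + b + c + e) = 1
  clear_value n
  simp only [Fin.exists_fin_two, Fin.forall_fin_two, add_zero, zero_add, h11] at *
  rcases (show n 0 0 0 0 = 1 ∨ n 0 0 0 1 = 1 by lia) with h | h
  · left
    omega
  · right
    omega

/-- The position of the exceptional entry of each column in each block of rows. -/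
theorem exists_positions (hC : IsCoveringArray 24 12 2 4 C) :
    ∃ (e : Fin 9 → Fin 2) (pos : Fin 2 × Fin 2 × Fin 2 → Fin 9 → Fin 24), ∀ k a b c r,
      (C r 0 = a ∧ C r 1 = b ∧ C r 2 = c ∧ C r (Fin.natAdd 3 k) = a + b + c + e k) ↔
        r = pos (a, b, c) k := by
  choose e he using hC.exists_card_eq_one
  have : ∀ (p : Fin 2 × Fin 2 × Fin 2) (k : Fin 9), ∃ s, ∀ r,
      (C r 0 = p.1 ∧ C r 1 = p.2.1 ∧ C r 2 = p.2.2 ∧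
        C r (Fin.natAdd 3 k) = p.1 + p.2.1 + p.2.2 + e k) ↔ r = s := by
    intro p k
    obtain ⟨s, hs⟩ := card_eq_one.1 (he k p.1 p.2.1 p.2.2)
    exact ⟨s, fun r => by simpa using congrArg (r ∈ ·) hs⟩
  choose pos hpos using this
  exact ⟨e, pos, fun k a b c r => hpos (a, b, c) k r⟩

theorem card_positions_agree (hC : IsCoveringArray 24 12 2 4 C) {e : Fin 9 → Fin 2}
    {pos : Fin 2 × Fin 2 × Fin 2 → Fin 9 → Fin 24}
    (hpos : ∀ k a b c r,
      (C r 0 = a ∧ C r 1 = b ∧ C r 2 = c ∧ C r (Fin.natAdd 3 k) = a + b + c + e k) ↔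
        r = pos (a, b, c) k) (k l : Fin 9) (a b c d : Fin 2) :
    #{r | C r 0 = a ∧ C r 1 = b ∧ C r 2 = c ∧ C r (Fin.natAdd 3 k) = d + e k ∧
      C r (Fin.natAdd 3 l) = d + e l} =
    (if pos (a, b, c) k = pos (a, b, c) l then 1 else 0) + if d = a + b + c then 0 else 1 := by
  have hodd : #{r | (C r 0 = a ∧ C r 1 = b ∧ C r 2 = c) ∧ C r (Fin.natAdd 3 k) = a + b + c + e k ∧
      C r (Fin.natAdd 3 l) = a + b + c + e l} =
      if pos (a, b, c) k = pos (a, b, c) l then 1 else 0 := by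
    have : ∀ r, ((C r 0 = a ∧ C r 1 = b ∧ C r 2 = c) ∧ C r (Fin.natAdd 3 k) = a + b + c + e k ∧
        C r (Fin.natAdd 3 l) = a + b + c + e l) ↔
        r = pos (a, b, c) k ∧ pos (a, b, c) k = pos (a, b, c) l := fun r => by
      have hk := hpos k a b c r
      have hl := hpos l a b c r
      constructor
      · rintro ⟨⟨h1, h2, h3⟩, h4, h5⟩
        have h6 := hk.1 ⟨h1, h2, h3, h4⟩
        exact ⟨h6, h6.symm.trans (hl.1 ⟨h1, h2, h3, h5⟩)⟩
      · rintro ⟨h6, h7⟩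
        obtain ⟨h1, h2, h3, h4⟩ := hk.2 h6
        obtain ⟨-, -, -, h5⟩ := hl.2 (h6.trans h7)
        exact ⟨⟨h1, h2, h3⟩, h4, h5⟩
    simp only [this]
    split_ifs with h <;> simp [h, filter_eq']
  by_cases hd : d = a + b + c
  · rw [if_pos hd, hd, ← hodd]
    simp only [and_assoc, add_zero]
  have hd' : ∀ x, d + x = a + b + c + x + 1 := by
    intro x
    generalize a + b + c = y at hd ⊢
    clear * - hd
    decide +revert
  rw [if_neg hd, hd', hd', ← hodd]
  have hone : ∀ j : Fin 9,
      #{r | (C r 0 = a ∧ C r 1 = b ∧ C r 2 = c) ∧ C r (Fin.natAdd 3 j) = a + b + c + e j} = 1 :=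
    fun j => by
      simp only [and_assoc, hpos]
      simp [filter_eq']
  have hk := hone k
  have hl := hone l
  have hblock := hC.card_eq_three (i := 0) (j := 1) (k := 2) (by decide) (by decide) (by decide)
    a b c
  generalize a + b + c + e k = x at *
  generalize a + b + c + e l = y at *
  have s1 := PairCovering.card_filter_and_add_card_filter_and
    (fun r => C r 0 = a ∧ C r 1 = b ∧ C r 2 = c) (C · (Fin.natAdd 3 k)) x
  have s2 := PairCovering.card_filter_and_add_card_filter_and
    (fun r => (C r 0 = a ∧ C r 1 = b ∧ C r 2 = c) ∧ C r (Fin.natAdd 3 k) = x + 1)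
    (C · (Fin.natAdd 3 l)) y
  have s3 := PairCovering.card_filter_and_add_card_filter_and
    (fun r => (C r 0 = a ∧ C r 1 = b ∧ C r 2 = c) ∧ C r (Fin.natAdd 3 l) = y)
    (C · (Fin.natAdd 3 k)) x
  simp only [and_assoc, and_comm (a := C _ (Fin.natAdd 3 l) = y)] at *
  lia

/-- The positions in opposite blocks agree simultaneously, and the positions of two distinct
columns agree in at most one pair of opposite blocks. -/
theorem positions_agree (hC : IsCoveringArray 24 12 2 4 C) {e : Fin 9 → Fin 2}
    {pos : Fin 2 × Fin 2 × Fin 2 → Fin 9 → Fin 24}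
    (hpos : ∀ k a b c r,
      (C r 0 = a ∧ C r 1 = b ∧ C r 2 = c ∧ C r (Fin.natAdd 3 k) = a + b + c + e k) ↔
        r = pos (a, b, c) k) {k l : Fin 9} (hkl : k ≠ l) :
    (∀ a b c, pos (a, b, c) k = pos (a, b, c) l ↔
      pos (0, a + b, a + c) k = pos (0, a + b, a + c) l) ∧
    ∀ p q : Fin 2 × Fin 2, p ≠ q → pos (0, p) k = pos (0, p) l → pos (0, q) k ≠ pos (0, q) l := by
  have h0 : ∀ j : Fin 9, (0 : Fin 12) ≠ Fin.natAdd 3 j := by decide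
  have h1 : ∀ j : Fin 9, (1 : Fin 12) ≠ Fin.natAdd 3 j := by decide
  have h2 : ∀ j : Fin 9, (2 : Fin 12) ≠ Fin.natAdd 3 j := by decide
  have hkl' : (Fin.natAdd 3 k : Fin 12) ≠ Fin.natAdd 3 l :=
    fun h => hkl (Fin.natAdd_injective _ _ h)
  have hA := fun a b c => hC.card_positions_agree hpos k l a b c 0
  set n : Fin 2 → Fin 2 → Fin 2 → ℕ := fun a b c =>
    #{r | C r 0 = a ∧ C r 1 = b ∧ C r 2 = c ∧ C r (Fin.natAdd 3 k) = 0 + e k ∧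
      C r (Fin.natAdd 3 l) = 0 + e l} with hn
  have f0 : ∀ a, n a 0 0 + n a 0 1 + (n a 1 0 + n a 1 1) = 3 := fun a => by
    rw [← hC.card_eq_three (h0 k) (h0 l) hkl' a (0 + e k) (0 + e l),
      ← PairCovering.card_filter_and_and _ (C · 1) (C · 2) 0 0]
    simp only [hn]
    congr 3 <;> (ext r; simp; tauto)
  have f1 : ∀ b, n 0 b 0 + n 0 b 1 + (n 1 b 0 + n 1 b 1) = 3 := fun b => by
    rw [← hC.card_eq_three (h1 k) (h1 l) hkl' b (0 + e k) (0 + e l),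
      ← PairCovering.card_filter_and_and _ (C · 0) (C · 2) 0 0]
    simp only [hn]
    congr 3 <;> (ext r; simp; tauto)
  have f2 : ∀ c, n 0 0 c + n 0 1 c + (n 1 0 c + n 1 1 c) = 3 := fun c => by
    rw [← hC.card_eq_three (h2 k) (h2 l) hkl' c (0 + e k) (0 + e l),
      ← PairCovering.card_filter_and_and _ (C · 0) (C · 1) 0 0]
    simp only [hn]
    congr 3 <;> (ext r; simp; tauto)
  set A : Fin 2 → Fin 2 → Fin 2 → ℕ := fun a b c =>
    if pos (a, b, c) k = pos (a, b, c) l then 1 else 0 with hAdef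
  change ∀ a b c, n a b c = A a b c + _ at hA
  have hiff : ∀ a b c, pos (a, b, c) k = pos (a, b, c) l ↔ A a b c = 1 := fun a b c => by
    simp [hAdef]
  have hle : ∀ a b c, A a b c ≤ 1 := fun a b c => by
    simp only [hAdef]
    split_ifs <;> simp
  have h11 : (1 : Fin 2) + 1 = 0 := by decide
  simp only [Prod.forall, Ne, hiff]
  clear_value n A
  clear hn hAdef hiff hpos h0 h1 h2 hkl' hkl
  simp only [Fin.forall_fin_two, add_zero, zero_add, h11, hA, Prod.mk.injEq, zero_ne_one,
    one_ne_zero, if_true, if_false] at *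
  clear hA
  have h01 : ∀ a b c, A a b c ≤ 1 → A a b c = 0 ∨ A a b c = 1 := fun a b c h => by lia
  obtain ⟨⟨⟨h000, h001⟩, h010, h011⟩, -⟩ := id hle
  rcases h01 _ _ _ h000 with h1 | h1 <;> rcases h01 _ _ _ h001 with h2 | h2 <;>
    rcases h01 _ _ _ h010 with h3 | h3 <;> rcases h01 _ _ _ h011 with h4 | h4 <;>
    first
    | omega
    | (simp [h1, h2, h3, h4]; omega)

/-- Every 24 × 12 binary 4-covering array is equivalent to `tetracodeArray`. -/
theorem exists_equiv_tetracodeArray (hC : IsCoveringArray 24 12 2 4 C) :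
    ∃ (ρ : (Fin 2 × Fin 2 × Fin 2) × Fin 3 ≃ Fin 24) (κ : Fin 3 ⊕ (Fin 3 × Fin 3) ≃ Fin 12)
      (f : Fin 3 ⊕ (Fin 3 × Fin 3) → Fin 2), ∀ x i, C (ρ x) (κ i) = tetracodeArray x i + f i := by
  obtain ⟨e, pos, hpos⟩ := hC.exists_positions
  have hblock : ∀ p : Fin 2 × Fin 2,
      #{r | C r 0 = 0 ∧ C r 1 = p.1 ∧ C r 2 = p.2} = 3 := fun p =>
    hC.card_eq_three (by decide) (by decide) (by decide) _ _ _
  have hmem : ∀ (p : Fin 2 × Fin 2) k, pos (0, p) k ∈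
      ({r | C r 0 = 0 ∧ C r 1 = p.1 ∧ C r 2 = p.2} : Finset (Fin 24)) := fun p k => by
    obtain ⟨h0, h1, h2, -⟩ := (hpos k 0 p.1 p.2 _).2 rfl
    simpa using ⟨h0, h1, h2⟩
  set w : Fin 2 × Fin 2 → Fin 9 → Fin 3 := fun p k =>
    Finset.equivFinOfCardEq (hblock p) ⟨pos (0, p) k, hmem p k⟩ with hw
  have hw' : ∀ p k l, w p k = w p l ↔ pos (0, p) k = pos (0, p) l := fun p k l => by
    simp [hw]
  obtain ⟨κ, hκ⟩ := exists_tetracode_coordinates w fun p q hpq k l hp hq => by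
    by_contra hkl
    exact (hC.positions_agree hpos hkl).2 p q hpq ((hw' p k l).1 hp) ((hw' q k l).1 hq)
  have hagree : ∀ a b c s t, pos (a, b, c) (κ s) = pos (a, b, c) (κ t) ↔
      lineForm (a + b, a + c) s = lineForm (a + b, a + c) t := fun a b c s t => by
    rw [← hκ, hw']
    by_cases hst : s = t
    · simp [hst]
    · exact (hC.positions_agree hpos (κ.injective.ne hst)).1 a b c
  have hsurj : ∀ (q : Fin 2 × Fin 2) (t : Fin 3), ∃ s, lineForm q s = t := by decide
  choose sec hsec using hsurj
  set ρ : (Fin 2 × Fin 2 × Fin 2) × Fin 3 → Fin 24 :=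
    fun x => pos x.1 (κ (sec (x.1.1 + x.1.2.1, x.1.1 + x.1.2.2) x.2)) with hρ
  have hρblock : ∀ a b c t, C (ρ ((a, b, c), t)) 0 = a ∧ C (ρ ((a, b, c), t)) 1 = b ∧
      C (ρ ((a, b, c), t)) 2 = c := fun a b c t => by
    obtain ⟨h0, h1, h2, -⟩ := (hpos (κ (sec (a + b, a + c) t)) a b c _).2 rfl
    exact ⟨h0, h1, h2⟩
  have hρpos : ∀ a b c t s, ρ ((a, b, c), t) = pos (a, b, c) (κ s) ↔
      t = lineForm (a + b, a + c) s := fun a b c t s => by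
    rw [hρ, hagree, hsec]
  have hρbij : Function.Bijective ρ := by
    refine (Fintype.bijective_iff_injective_and_card _).2 ⟨?_, by simp⟩
    rintro ⟨⟨a, b, c⟩, t⟩ ⟨⟨a', b', c'⟩, t'⟩ h
    obtain ⟨h0, h1, h2⟩ := hρblock a b c t
    obtain ⟨h0', h1', h2'⟩ := hρblock a' b' c' t'
    rw [h] at h0 h1 h2
    obtain rfl := h0.symm.trans h0'
    obtain rfl := h1.symm.trans h1'
    obtain rfl := h2.symm.trans h2'
    have := (hρpos a b c t _).1 h
    rw [hsec] at this
    rw [this]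
  refine ⟨Equiv.ofBijective ρ hρbij,
    ((Equiv.refl _).sumCongr κ).trans finSumFinEquiv, Sum.elim 0 (fun s => e (κ s)), ?_⟩
  rintro ⟨⟨a, b, c⟩, t⟩ (i | s)
  · obtain ⟨h0, h1, h2⟩ := hρblock a b c t
    fin_cases i
    · exact h0.trans (by simp [tetracodeArray])
    · exact h1.trans (by simp [tetracodeArray])
    · exact h2.trans (by simp [tetracodeArray])
  · obtain ⟨h0, h1, h2⟩ := hρblock a b c t
    have h := hpos (κ s) a b c (ρ ((a, b, c), t))
    rw [hρpos] at h
    simp only [h0, h1, h2, true_and] at h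
    change C (ρ ((a, b, c), t)) (Fin.natAdd 3 (κ s)) =
      (if t = lineForm (a + b, a + c) s then a + b + c else a + b + c + 1) + e (κ s)
    split_ifs with ht
    · exact h.2 ht
    · have hne := mt h.1 ht
      generalize C (ρ ((a, b, c), t)) (Fin.natAdd 3 (κ s)) = x at hne
      generalize e (κ s) = y at hne
      generalize a + b + c = z at hne
      clear * - hne
      decide +revert

theorem caEquiv {C' : Fin 24 → Fin 12 → Fin 2} (hC : IsCoveringArray 24 12 2 4 C)
    (hC' : IsCoveringArray 24 12 2 4 C') : CAEquiv C C' := by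
  obtain ⟨ρ, κ, f, h⟩ := hC.exists_equiv_tetracodeArray
  obtain ⟨ρ', κ', f', h'⟩ := hC'.exists_equiv_tetracodeArray
  refine ⟨ρ'.symm.trans ρ, κ'.symm.trans κ,
    fun i => Equiv.addRight (f' (κ'.symm i) - f (κ'.symm i)), fun r i => ?_⟩
  have hr := h' (ρ'.symm r) (κ'.symm i)
  rw [ρ'.apply_symm_apply, κ'.apply_symm_apply] at hr
  simp [hr, h]

end IsCoveringArray

/-- The columns of a 24 × 12 binary 4-covering array, as bit masks. -/
def columnMask : Fin 12 → ℕ :=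
  ![16773120, 16519104, 14913080, 3873870, 3589782, 2992934, 5941901, 5610773, 5195365, 10077963,
    9906771, 9346211]

/-- The rows in which column `i` of the array given by `columnMask` has entry `a`. -/
def rowMask (i : Fin 12) (a : Fin 2) : ℕ :=
  if a = 1 then columnMask i else 2 ^ 24 - 1 - columnMask i

theorem rowMask_inter_ne_zero : ∀ i j : Fin 12, i < j → ∀ k, j < k → ∀ l, k < l →
    ∀ a b c d : Fin 2, rowMask i a &&& rowMask j b &&& rowMask k c &&& rowMask l d ≠ 0 := by
  decide +kernel

theorem testBit_rowMask : ∀ i a (r : ℕ), (rowMask i a).testBit r = true →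
    r < 24 ∧ (if (columnMask i).testBit r then 1 else 0) = a := by
  have hlt : ∀ i a, rowMask i a < 2 ^ 24 := by decide
  have hbit : ∀ i a, ∀ r < 24, (rowMask i a).testBit r = true →
      (if (columnMask i).testBit r then 1 else 0) = a := by decide +kernel
  intro i a r h
  have hr : r < 24 := by
    by_contra! hr
    rw [Nat.testBit_lt_two_pow ((hlt i a).trans_le (Nat.pow_le_pow_right two_pos hr))] at h
    simp at h
  exact ⟨hr, hbit i a r hr h⟩

theorem isCoveringArray_columnMask : IsCoveringArray 24 12 2 4
    fun r i => if (columnMask i).testBit r then 1 else 0 := by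
  intro cols hcols v
  have hcard : #(univ.image cols) = 4 := by
    rw [card_image_of_injective _ hcols, card_univ, Fintype.card_fin]
  set s := (univ.image cols).orderEmbOfFin hcard
  set u : Fin 12 → Fin 2 := Function.extend cols v 0
  obtain ⟨r, hr⟩ := Nat.exists_testBit_of_ne_zero <| rowMask_inter_ne_zero (s 0) (s 1)
    (s.lt_iff_lt.2 (by decide)) (s 2) (s.lt_iff_lt.2 (by decide)) (s 3)
    (s.lt_iff_lt.2 (by decide)) (u (s 0)) (u (s 1)) (u (s 2)) (u (s 3))
  simp only [Nat.testBit_and, Bool.and_eq_true] at hr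
  obtain ⟨⟨⟨h0, h1⟩, h2⟩, h3⟩ := hr
  refine ⟨⟨r, (testBit_rowMask _ _ _ h0).1⟩, fun j => ?_⟩
  have hj : cols j ∈ Set.range s := by
    rw [range_orderEmbOfFin]
    simp
  obtain ⟨t, ht⟩ := hj
  rw [← hcols.extend_apply v 0 j, ← ht]
  refine (testBit_rowMask _ _ _ ?_).2
  fin_cases t
  exacts [h0, h1, h2, h3]

/-- `CAN(4,12,2) = 24`: a `24 × 12` binary 4-covering array exists, no
`23 × 12` binary 4-covering array exists, and any two `24 × 12` binary 4-covering arrays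
are equivalent. -/
theorem ca_24_12_unique :
    CAN 4 12 2 = 24 ∧
    (∃ C : Fin 24 → Fin 12 → Fin 2, IsCoveringArray 24 12 2 4 C) ∧
    (∀ C : Fin 23 → Fin 12 → Fin 2, ¬ IsCoveringArray 23 12 2 4 C) ∧
    (∀ C C' : Fin 24 → Fin 12 → Fin 2, IsCoveringArray 24 12 2 4 C →
      IsCoveringArray 24 12 2 4 C' → CAEquiv C C') := by
  have hlb : ∀ m, ∀ C : Fin m → Fin 12 → Fin 2, IsCoveringArray m 12 2 4 C → 24 ≤ m :=
    fun _ _ hC => hC.le_card_rows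
  refine ⟨le_antisymm (Nat.sInf_le ⟨_, isCoveringArray_columnMask⟩) ?_,
    ⟨_, isCoveringArray_columnMask⟩, fun C hC => absurd (hlb 23 C hC) (by decide),
    fun C C' hC hC' => hC.caEquiv hC'⟩
  refine le_csInf ⟨24, _, isCoveringArray_columnMask⟩ ?_
  rintro m ⟨C, hC⟩
  exact hlb m C hC
end
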